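/- arXiv:1205.1247 — 4 statements merged into one kernel-verified Lean document; each statement's English description precedes it below -/
import Mathlib

section
/- Let E = (E⁰, E¹, r, s) be a directed graph, H ⊆ E⁰ a hereditary subset, S ⊆ B_H, and let α = e₁⋯eₙ (n ≥ 1) be a path in E with r(eₙ) ∈ H. Then exactly one of the following four cases holds: (I) s(eᵢ) ∈ H for all 1 ≤ i ≤ n; (II) s(e₁) ∈ S, r(e₁) ∈ H, and s(eᵢ) ∈ H for all 2 ≤ i ≤ n; (III) there exists 1 ≤ k ≤ n such that e₁⋯e_k ∈ F₁(H,S) and s(eᵢ) ∈ H for all k < i ≤ n; (IV) there exists 1 ≤ k ≤ n−1 such that e₁⋯e_k ∈ F₂(H,S), s(e_{k+1}) ∈ S, r(e_{k+1}) ∈ H, and s(eᵢ) ∈ H for all k+1 < i ≤ n. Moreover, the index k in case (III), respectively case (IV), is unique. -/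
namespace GraphIdeals

variable {V E : Type*}

/-- Composability relation between edges: the range of the first equals the source
of the second.  A path of length `n ≥ 1` is a nonempty `List E` that is a chain
for this relation. -/
def pathRel (r s : E → V) : E → E → Prop := fun e f => r e = s f

/-- A subset `H` of vertices is hereditary if `s(e) ∈ H` implies `r(e) ∈ H`. -/
def Hereditary (r s : E → V) (H : Set V) : Prop := ∀ e : E, s e ∈ H → r e ∈ H

/-- The set of breaking vertices of `H`: infinite emitters with a finite nonzero
number of edges into the complement of `H`. -/
def breakingVertices (r s : E → V) (H : Set V) : Set V :=
  {v | (s ⁻¹' {v}).Infinite ∧ {e : E | s e = v ∧ r e ∉ H}.Finite ∧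
      {e : E | s e = v ∧ r e ∉ H}.Nonempty}

/-- `F₁(H,S)`: paths `e₁ ⋯ eₙ` of length `≥ 1` with `r(eₙ) ∈ H` and `s(eₙ) ∉ H ∪ S`. -/
def F1 (r s : E → V) (H S : Set V) : Set (List E) :=
  {p | ∃ h : p ≠ [], p.Chain' (pathRel r s) ∧
        r (p.getLast h) ∈ H ∧ s (p.getLast h) ∉ H ∪ S}

/-- `F₂(H,S)`: paths of length `≥ 1` with range in `S`. -/
def F2 (r s : E → V) (H S : Set V) : Set (List E) :=
  {p | ∃ h : p ≠ [], p.Chain' (pathRel r s) ∧ r (p.getLast h) ∈ S}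


/-- Case (I): every edge of the path has source in `H`. -/
def CaseI (s : E → V) (H : Set V) (p : List E) : Prop := ∀ e ∈ p, s e ∈ H

/-- Case (II): `s(e₁) ∈ S`, `r(e₁) ∈ H`, and `s(eᵢ) ∈ H` for `2 ≤ i ≤ n`
(indices of `p.get` are `0`-based). -/
def CaseII (r s : E → V) (H S : Set V) (p : List E) (hp : p ≠ []) : Prop :=
  s (p.head hp) ∈ S ∧ r (p.head hp) ∈ H ∧
    ∀ i : ℕ, ∀ hi : i < p.length, 1 ≤ i → s (p.get ⟨i, hi⟩) ∈ H

/-- Case (III) with break index `k`: `e₁ ⋯ e_k ∈ F₁(H,S)` (`1 ≤ k ≤ n`) and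
`s(eᵢ) ∈ H` for `k < i ≤ n`. -/
def CaseIII (r s : E → V) (H S : Set V) (p : List E) (k : ℕ) : Prop :=
  1 ≤ k ∧ k ≤ p.length ∧ p.take k ∈ F1 r s H S ∧
    ∀ i : ℕ, ∀ hi : i < p.length, k ≤ i → s (p.get ⟨i, hi⟩) ∈ H

/-- Case (IV) with break index `k`: `e₁ ⋯ e_k ∈ F₂(H,S)` (`1 ≤ k ≤ n − 1`),
`s(e_{k+1}) ∈ S`, `r(e_{k+1}) ∈ H`, and `s(eᵢ) ∈ H` for `k + 1 < i ≤ n`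
(the edge `e_{k+1}` is `p.get ⟨k, _⟩` in `0`-based indexing). -/
def CaseIV (r s : E → V) (H S : Set V) (p : List E) (k : ℕ) : Prop :=
  ∃ hk : k < p.length, 1 ≤ k ∧ p.take k ∈ F2 r s H S ∧
    s (p.get ⟨k, hk⟩) ∈ S ∧ r (p.get ⟨k, hk⟩) ∈ H ∧
    ∀ i : ℕ, ∀ hi : i < p.length, k + 1 ≤ i → s (p.get ⟨i, hi⟩) ∈ H

/-- The `0`-based index `m` is the last one at which the path `p` has its source outside `H`. -/
def IsLastExit (s : E → V) (H : Set V) (p : List E) (m : ℕ) : Prop :=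
  ∃ hm : m < p.length, s (p.get ⟨m, hm⟩) ∉ H ∧
    ∀ i : ℕ, ∀ hi : i < p.length, m + 1 ≤ i → s (p.get ⟨i, hi⟩) ∈ H

theorem IsLastExit.unique {s : E → V} {H : Set V} {p : List E} {m n : ℕ}
    (hm : IsLastExit s H p m) (hn : IsLastExit s H p n) : m = n := by
  obtain ⟨hm, hm', hm''⟩ := hm
  obtain ⟨hn, hn', hn''⟩ := hn
  rcases lt_trichotomy m n with h | h | h
  · exact absurd (hm'' n hn h) hn'
  · exact h
  · exact absurd (hn'' m hm h) hm'

theorem IsLastExit.not_caseI {s : E → V} {H : Set V} {p : List E} {m : ℕ}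
    (hm : IsLastExit s H p m) : ¬CaseI s H p := by
  obtain ⟨hm, hm', -⟩ := hm
  exact fun h => hm' (h _ (List.get_mem p ⟨m, hm⟩))

theorem exists_isLastExit {s : E → V} {H : Set V} {p : List E} (h : ¬CaseI s H p) :
    ∃ m, IsLastExit s H p m := by
  classical
  let P : ℕ → Prop := fun i => ∃ hi : i < p.length, s (p.get ⟨i, hi⟩) ∉ H
  obtain ⟨j, hj, hjP⟩ : ∃ j ≤ p.length, P j := by
    unfold CaseI at h
    push Not at h
    obtain ⟨e, he, heH⟩ := h
    obtain ⟨⟨i, hi⟩, rfl⟩ := List.get_of_mem he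
    exact ⟨i, hi.le, hi, heH⟩
  obtain ⟨hm, hmH⟩ := Nat.findGreatest_spec hj hjP
  refine ⟨Nat.findGreatest P p.length, hm, hmH, fun i hi hlt => ?_⟩
  by_contra hiH
  exact Nat.findGreatest_is_greatest hlt hi.le ⟨hi, hiH⟩

theorem disjoint_breakingVertices {r s : E → V} {H : Set V} (hH : Hereditary r s H) :
    Disjoint (breakingVertices r s H) H := by
  rw [Set.disjoint_left]
  rintro v ⟨-, -, e, rfl, he⟩ hv
  exact he (hH e hv)

theorem getLast_take_succ {p : List E} {m : ℕ} (hm : m < p.length) (h : p.take (m + 1) ≠ []) :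
    (p.take (m + 1)).getLast h = p.get ⟨m, hm⟩ := by
  simp [List.getLast_eq_getElem, Nat.min_eq_left (Nat.succ_le_of_lt hm)]

theorem take_succ_ne_nil {p : List E} {m : ℕ} (hm : m < p.length) : p.take (m + 1) ≠ [] := by
  apply List.ne_nil_of_length_pos
  rw [List.length_take]
  omega

theorem range_get_eq_source_get {r s : E → V} {p : List E}
    (hchain : p.IsChain (pathRel r s)) {m : ℕ} (hm : m + 1 < p.length) :
    r (p.get ⟨m, m.lt_succ_self.trans hm⟩) = s (p.get ⟨m + 1, hm⟩) :=
  List.isChain_iff_getElem.1 hchain m hm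

theorem IsLastExit.range_mem {r s : E → V} {H : Set V} {p : List E} {m : ℕ}
    (h : IsLastExit s H p m) (hp : p ≠ []) (hchain : p.IsChain (pathRel r s))
    (hrng : r (p.getLast hp) ∈ H) :
    ∃ hm : m < p.length, r (p.get ⟨m, hm⟩) ∈ H := by
  obtain ⟨hm, -, htail⟩ := h
  refine ⟨hm, ?_⟩
  by_cases hlt : m + 1 < p.length
  · rw [range_get_eq_source_get hchain hlt]
    exact htail _ hlt le_rfl
  · obtain rfl : m = p.length - 1 := by omega
    rwa [List.getLast_eq_getElem] at hrng

theorem CaseII.isLastExit {r s : E → V} {H S : Set V} {p : List E} {hp : p ≠ []}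
    (hSH : Disjoint S H) (h : CaseII r s H S p hp) :
    IsLastExit s H p 0 ∧ ∃ hm : 0 < p.length, s (p.get ⟨0, hm⟩) ∈ S := by
  obtain ⟨hS, -, htail⟩ := h
  rw [List.head_eq_getElem] at hS
  have hm := List.length_pos_of_ne_nil hp
  exact ⟨⟨hm, Set.disjoint_left.1 hSH hS, htail⟩, hm, hS⟩

theorem CaseIII.exists_isLastExit {r s : E → V} {H S : Set V} {p : List E} {k : ℕ}
    (h : CaseIII r s H S p k) :
    ∃ m, k = m + 1 ∧ IsLastExit s H p m ∧ ∃ hm : m < p.length, s (p.get ⟨m, hm⟩) ∉ S := by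
  obtain ⟨hk, hkp, ⟨hne, -, -, hs⟩, htail⟩ := h
  obtain ⟨m, rfl⟩ : ∃ m, k = m + 1 := ⟨k - 1, by omega⟩
  rw [getLast_take_succ hkp, Set.mem_union, not_or] at hs
  exact ⟨m, rfl, ⟨hkp, hs.1, htail⟩, hkp, hs.2⟩

theorem CaseIV.isLastExit {r s : E → V} {H S : Set V} {p : List E} {k : ℕ}
    (hSH : Disjoint S H) (h : CaseIV r s H S p k) :
    1 ≤ k ∧ IsLastExit s H p k ∧ ∃ hk : k < p.length, s (p.get ⟨k, hk⟩) ∈ S := by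
  obtain ⟨hkp, hk, -, hS, -, htail⟩ := h
  exact ⟨hk, ⟨hkp, Set.disjoint_left.1 hSH hS, htail⟩, hkp, hS⟩

theorem IsLastExit.caseII_or_caseIII_or_caseIV {r s : E → V} {H : Set V} {p : List E} {m : ℕ}
    (S : Set V) (h : IsLastExit s H p m) (hp : p ≠ []) (hchain : p.IsChain (pathRel r s))
    (hrng : r (p.getLast hp) ∈ H) :
    CaseII r s H S p hp ∨ (∃ k, CaseIII r s H S p k) ∨ ∃ k, CaseIV r s H S p k := by
  obtain ⟨hm, hr⟩ := h.range_mem hp hchain hrng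
  obtain ⟨_, hsH, htail⟩ := h
  by_cases hS : s (p.get ⟨m, hm⟩) ∈ S
  · rcases m with _ | m
    · left
      refine ⟨?_, ?_, htail⟩ <;> rwa [List.head_eq_getElem]
    · right; right
      have hm' : m < p.length := m.lt_succ_self.trans hm
      refine ⟨m + 1, hm, m.succ_pos, ⟨take_succ_ne_nil hm', hchain.take _, ?_⟩, hS, hr, htail⟩
      rwa [getLast_take_succ hm', range_get_eq_source_get hchain hm]
  · right; left
    refine ⟨m + 1, m.succ_pos, hm, ⟨take_succ_ne_nil hm, hchain.take _, ?_⟩, htail⟩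
    rw [getLast_take_succ hm]
    exact ⟨hr, not_or.2 ⟨hsH, hS⟩⟩

/-- Let `H` be hereditary, `S ⊆ B_H`, and let `p = e₁ ⋯ eₙ` (`n ≥ 1`)
be a path with `r(eₙ) ∈ H`.  Then exactly one of the four cases (I)–(IV) holds, and
the break index `k` in case (III), respectively (IV), is unique. -/
theorem path_into_H_four_cases
    (r s : E → V) (H S : Set V) (hH : Hereditary r s H)
    (hS : S ⊆ breakingVertices r s H)
    (p : List E) (hp : p ≠ []) (hchain : p.Chain' (pathRel r s))
    (hrng : r (p.getLast hp) ∈ H) :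
    (CaseI s H p ∨ CaseII r s H S p hp ∨ (∃ k, CaseIII r s H S p k) ∨
        (∃ k, CaseIV r s H S p k)) ∧
    ¬(CaseI s H p ∧ CaseII r s H S p hp) ∧
    ¬(CaseI s H p ∧ ∃ k, CaseIII r s H S p k) ∧
    ¬(CaseI s H p ∧ ∃ k, CaseIV r s H S p k) ∧
    ¬(CaseII r s H S p hp ∧ ∃ k, CaseIII r s H S p k) ∧
    ¬(CaseII r s H S p hp ∧ ∃ k, CaseIV r s H S p k) ∧
    ¬((∃ k, CaseIII r s H S p k) ∧ ∃ k, CaseIV r s H S p k) ∧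
    (∀ k k', CaseIII r s H S p k → CaseIII r s H S p k' → k = k') ∧
    (∀ k k', CaseIV r s H S p k → CaseIV r s H S p k' → k = k') := by
  have hSH : Disjoint S H := (disjoint_breakingVertices hH).mono_left hS
  refine ⟨?_, ?_, ?_, ?_, ?_, ?_, ?_, ?_, ?_⟩
  · by_cases h : CaseI s H p
    · exact Or.inl h
    · obtain ⟨m, hm⟩ := exists_isLastExit h
      exact Or.inr (hm.caseII_or_caseIII_or_caseIV S hp hchain hrng)
  · rintro ⟨h, h'⟩
    exact (h'.isLastExit hSH).1.not_caseI h
  · rintro ⟨h, k, h'⟩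
    obtain ⟨m, -, hm, -⟩ := h'.exists_isLastExit
    exact hm.not_caseI h
  · rintro ⟨h, k, h'⟩
    exact (h'.isLastExit hSH).2.1.not_caseI h
  · rintro ⟨h, k, h'⟩
    obtain ⟨h0, _, h0S⟩ := h.isLastExit hSH
    obtain ⟨m, -, hm, _, hmS⟩ := h'.exists_isLastExit
    obtain rfl := h0.unique hm
    exact hmS h0S
  · rintro ⟨h, k, h'⟩
    obtain ⟨hk, hk', -⟩ := h'.isLastExit hSH
    have := (h.isLastExit hSH).1.unique hk'
    omega
  · rintro ⟨⟨k, h⟩, k', h'⟩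
    obtain ⟨m, -, hm, _, hmS⟩ := h.exists_isLastExit
    obtain ⟨-, hk', _, hkS⟩ := h'.isLastExit hSH
    obtain rfl := hm.unique hk'
    exact hmS hkS
  · intro k k' h h'
    obtain ⟨m, rfl, hm, -⟩ := h.exists_isLastExit
    obtain ⟨m', rfl, hm', -⟩ := h'.exists_isLastExit
    rw [hm.unique hm']
  · intro k k' h h'
    exact (h.isLastExit hSH).2.1.unique (h'.isLastExit hSH).2.1

end GraphIdeals
end

section
/- Let E = (E⁰, E¹, r, s) be a directed graph, H ⊆ E⁰ a saturated hereditary subset, and S ⊆ B_H. Then every cycle in the graph \overline{E}_{(H,S)} consists entirely of edges belonging to {e ∈ E¹ : s(e) ∈ H}, and the map sending a cycle of E all of whose edges have source in H to the same sequence of edges, viewed in \overline{E}_{(H,S)}, is a bijection from the set of cycles of E all of whose edges have source in H onto the set of cycles of \overline{E}_{(H,S)}. In particular, the construction \overline{E}_{(H,S)} creates no additional cycles. -/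
namespace GraphIdeals

variable {V E : Type*}

/-- A vertex is regular if it emits a finite nonzero number of edges. -/
def Regular (s : E → V) (v : V) : Prop := (s ⁻¹' {v}).Finite ∧ (s ⁻¹' {v}).Nonempty

/-- A hereditary set `H` is saturated if every regular vertex all of whose emitted
edges have range in `H` belongs to `H`. -/
def Saturated (r s : E → V) (H : Set V) : Prop :=
  ∀ v : V, Regular s v → (∀ e : E, s e = v → r e ∈ H) → v ∈ H

/-- Vertices of the graph `Ē_{(H,S)}`: the disjoint union `H ⊔ S ⊔ F₁(H,S) ⊔ F₂(H,S)`. -/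
abbrev BarV (r s : E → V) (H S : Set V) : Type _ :=
  ({v : V // v ∈ H} ⊕ {v : V // v ∈ S}) ⊕
    ({p : List E // p ∈ F1 r s H S} ⊕ {p : List E // p ∈ F2 r s H S})

/-- Edges of the graph `Ē_{(H,S)}`: the disjoint union
`{e ∈ E¹ : s(e) ∈ H} ⊔ {e ∈ E¹ : s(e) ∈ S, r(e) ∈ H} ⊔ {ā : α ∈ F₁} ⊔ {ā : α ∈ F₂}`. -/
abbrev BarE (r s : E → V) (H S : Set V) : Type _ :=
  ({e : E // s e ∈ H} ⊕ {e : E // s e ∈ S ∧ r e ∈ H}) ⊕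
    ({p : List E // p ∈ F1 r s H S} ⊕ {p : List E // p ∈ F2 r s H S})

/-- The source map of `Ē_{(H,S)}`: edges coming from `E¹` keep their source, and
`s(ā) = α`. -/
def barS (r s : E → V) (H S : Set V) : BarE r s H S → BarV r s H S
  | .inl (.inl e) => .inl (.inl ⟨s e.1, e.2⟩)
  | .inl (.inr e) => .inl (.inr ⟨s e.1, e.2.1⟩)
  | .inr (.inl p) => .inr (.inl p)
  | .inr (.inr p) => .inr (.inr p)

/-- The range map of `Ē_{(H,S)}` (well defined since `H` is hereditary): edges coming
from `E¹` keep their range, and `r(ā) = r(α)`. -/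
def barR (r s : E → V) (H S : Set V) (hH : Hereditary r s H) :
    BarE r s H S → BarV r s H S
  | .inl (.inl e) => .inl (.inl ⟨r e.1, hH e.1 e.2⟩)
  | .inl (.inr e) => .inl (.inl ⟨r e.1, e.2.2⟩)
  | .inr (.inl p) => .inl (.inl ⟨r (p.1.getLast p.2.choose), p.2.choose_spec.2.1⟩)
  | .inr (.inr p) => .inl (.inr ⟨r (p.1.getLast p.2.choose), p.2.choose_spec.2⟩)

/-- A cycle in a graph with edge set `E`, range `r` and source `s`: a path of length
`≥ 1` whose source equals its range. -/
def IsCycle {V E : Type*} (r s : E → V) (p : List E) : Prop :=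
  ∃ h : p ≠ [], p.Chain' (pathRel r s) ∧ s (p.head h) = r (p.getLast h)

/-- The underlying label of an edge of `Ē_{(H,S)}`: an edge of `E` or a path `α`
(for the edges `ā`), forgetting the membership proofs. -/
def barProj (r s : E → V) (H S : Set V) : BarE r s H S → E ⊕ List E
  | .inl (.inl e) => .inl e.1
  | .inl (.inr e) => .inl e.1
  | .inr (.inl p) => .inr p.1
  | .inr (.inr p) => .inr p.1

/-- Every edge of a cycle is preceded by some edge of the cycle. -/
theorem IsCycle.exists_pred {V E : Type*} {r s : E → V} {p : List E} (hp : IsCycle r s p)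
    {x : E} (hx : x ∈ p) : ∃ y ∈ p, s x = r y := by
  obtain ⟨hne, hc, hl⟩ := hp
  obtain ⟨l₁, l₂, rfl⟩ := List.append_of_mem hx
  rcases List.eq_nil_or_concat l₁ with rfl | ⟨l, y, rfl⟩
  · exact ⟨_, List.getLast_mem hne, hl⟩
  · refine ⟨y, by simp, ?_⟩
    have h := (List.isChain_append.mp hc).2.2 y (by simp) x (by simp)
    exact h.symm

theorem isCycle_iff {V E : Type*} {r s : E → V} {p : List E} :
    IsCycle r s p ↔
      ∃ h : p ≠ [], p.IsChain (fun e f => r e = s f) ∧ s (p.head h) = r (p.getLast h) :=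
  Iff.rfl

/-- Being a cycle depends only on the composability of the edges. -/
theorem isCycle_map_iff {A V E V' E' : Type*} {r s : E → V} {r' s' : E' → V'}
    {f : A → E} {g : A → E'} (hfg : ∀ a b, r (f a) = s (f b) ↔ r' (g a) = s' (g b))
    (l : List A) : IsCycle r s (l.map f) ↔ IsCycle r' s' (l.map g) := by
  have key : ∀ a b, s (f b) = r (f a) ↔ s' (g b) = r' (g a) := fun a b => by
    rw [eq_comm, hfg, eq_comm]
  simp only [isCycle_iff, List.isChain_map, hfg, List.head_map, List.getLast_map, key,
    ne_eq, List.map_eq_nil_iff]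

/-- The inclusion of the edges with source in `H` into the edges of `Ē_{(H,S)}`. -/
def barIncl (r s : E → V) (H S : Set V) (e : {e : E // s e ∈ H}) : BarE r s H S :=
  .inl (.inl e)

theorem barIncl_injective (r s : E → V) (H S : Set V) :
    Function.Injective (barIncl r s H S) :=
  Sum.inl_injective.comp Sum.inl_injective

theorem map_barProj_map_barIncl (r s : E → V) (H S : Set V) (l : List {e : E // s e ∈ H}) :
    (l.map (barIncl r s H S)).map (barProj r s H S) = (l.map Subtype.val).map Sum.inl := by
  simp [barIncl, barProj, Function.comp_def]

theorem isCycle_map_barIncl (r s : E → V) (H S : Set V) (hH : Hereditary r s H)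
    (l : List {e : E // s e ∈ H}) :
    IsCycle (barR r s H S hH) (barS r s H S) (l.map (barIncl r s H S)) ↔
      IsCycle r s (l.map Subtype.val) :=
  isCycle_map_iff (fun a b => by simp [barIncl, barR, barS]) l

/-- The source of an edge of a cycle of `Ē_{(H,S)}` is the range of an edge, hence not a path. -/
theorem IsCycle.exists_eq_inl {r s : E → V} {H S : Set V} {hH : Hereditary r s H}
    {q : List (BarE r s H S)} (hq : IsCycle (barR r s H S hH) (barS r s H S) q)
    {x : BarE r s H S} (hx : x ∈ q) : ∃ a, x = Sum.inl a := by
  obtain ⟨y, -, hxy⟩ := hq.exists_pred hx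
  rcases x with a | x | x
  · exact ⟨a, rfl⟩
  all_goals rcases y with (y | y) | y | y <;> simp [barR, barS] at hxy

theorem IsCycle.mem_range_barIncl {r s : E → V} {H S : Set V} {hH : Hereditary r s H}
    {q : List (BarE r s H S)} (hq : IsCycle (barR r s H S hH) (barS r s H S) q)
    {x : BarE r s H S} (hx : x ∈ q) : x ∈ Set.range (barIncl r s H S) := by
  obtain ⟨y, hy, hxy⟩ := hq.exists_pred hx
  obtain ⟨b, rfl⟩ := hq.exists_eq_inl hy
  obtain ⟨a | a, rfl⟩ := hq.exists_eq_inl hx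
  · exact ⟨a, rfl⟩
  · rcases b with b | b <;> simp [barR, barS] at hxy

theorem IsCycle.exists_map_barIncl {r s : E → V} {H S : Set V} {hH : Hereditary r s H}
    {q : List (BarE r s H S)} (hq : IsCycle (barR r s H S hH) (barS r s H S) q) :
    ∃ l : List {e : E // s e ∈ H}, l.map (barIncl r s H S) = q := by
  rw [← Set.mem_range, Set.range_list_map]
  exact fun _ hx => hq.mem_range_barIncl hx

/-- For `H` saturated hereditary and `S ⊆ B_H`: every cycle of
`Ē_{(H,S)}` consists entirely of edges coming from `{e ∈ E¹ : s(e) ∈ H}`, and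
"same sequence of edges" is a bijection between cycles of `E` all of whose edges have
source in `H` and cycles of `Ē_{(H,S)}`; in particular the construction creates no
additional cycles. -/
theorem cycles_of_bar_graph
    (r s : E → V) (H S : Set V) (hH : Hereditary r s H) (hSat : Saturated r s H)
    (hS : S ⊆ breakingVertices r s H) :
    (∀ q : List (BarE r s H S),
        IsCycle (barR r s H S hH) (barS r s H S) q →
        ∀ x ∈ q, ∃ e : E, ∃ he : s e ∈ H, x = Sum.inl (Sum.inl ⟨e, he⟩)) ∧
    (∀ p : List E, IsCycle r s p → (∀ e ∈ p, s e ∈ H) →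
        ∃! q : List (BarE r s H S),
          IsCycle (barR r s H S hH) (barS r s H S) q ∧
            q.map (barProj r s H S) = p.map Sum.inl) ∧
    (∀ q : List (BarE r s H S),
        IsCycle (barR r s H S hH) (barS r s H S) q →
        ∃! p : List E, (IsCycle r s p ∧ ∀ e ∈ p, s e ∈ H) ∧
          q.map (barProj r s H S) = p.map Sum.inl) := by
  refine ⟨fun q hq x hx => ?_, fun p hp hpH => ?_, fun q hq => ?_⟩
  · obtain ⟨e, rfl⟩ := hq.mem_range_barIncl hx
    exact ⟨e.1, e.2, rfl⟩
  · lift p to List {e : E // s e ∈ H} using hpH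
    refine ⟨p.map (barIncl r s H S), ⟨(isCycle_map_barIncl r s H S hH p).2 hp,
      map_barProj_map_barIncl r s H S p⟩, ?_⟩
    rintro q ⟨hq, hqp⟩
    obtain ⟨l, rfl⟩ := hq.exists_map_barIncl
    rw [map_barProj_map_barIncl] at hqp
    rw [Subtype.val_injective.list_map (Sum.inl_injective.list_map hqp)]
  · obtain ⟨l, rfl⟩ := hq.exists_map_barIncl
    refine ⟨l.map Subtype.val, ⟨⟨(isCycle_map_barIncl r s H S hH l).1 hq, ?_⟩,
      map_barProj_map_barIncl r s H S l⟩, ?_⟩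
    · intro e he
      obtain ⟨a, -, rfl⟩ := List.mem_map.1 he
      exact a.2
    · rintro p ⟨-, hp⟩
      rw [map_barProj_map_barIncl] at hp
      exact (Sum.inl_injective.list_map hp).symm

end GraphIdeals
end

section
/- Let E = (E⁰, E¹, r, s) be a directed graph, H ⊆ E⁰ a saturated hereditary subset, S ⊆ B_H, A a complex C*-algebra, and {P_v, S_e : v ∈ E⁰, e ∈ E¹} a Cuntz–Krieger E-family in A. For each vertex w of \overline{E}_{(H,S)} define Q_w := P_w if w ∈ H; Q_w := P_w^H if w ∈ S; Q_w := S_α S_α* if w = α ∈ F₁(H,S); Q_w := S_α P_{r(α)}^H S_α* if w = α ∈ F₂(H,S). For each edge f of \overline{E}_{(H,S)} define T_f := S_f if f ∈ E¹; T_f := S_α if f = ā with α ∈ F₁(H,S); T_f := S_α P_{r(α)}^H if f = ā with α ∈ F₂(H,S). Then {Q_w, T_f} is a Cuntz–Krieger \overline{E}_{(H,S)}-family in A: the Q_w are mutually orthogonal projections; the T_f are partial isometries with mutually orthogonal ranges; T_f* T_f = Q_{r(f)} and T_f T_f* ≤ Q_{s(f)} for every edge f of \overline{E}_{(H,S)};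 and Q_w = Σ_{s(f)=w} T_f T_f* for every regular vertex w of \overline{E}_{(H,S)}. -/
namespace GraphIdeals

variable {V E : Type*}

section CStar

variable {A : Type*} [NonUnitalCStarAlgebra A]

/-- The operator `S_α = S_{e₁} ⋯ S_{eₙ}` associated to a path `α = e₁ ⋯ eₙ`
(with junk value `0` on the empty list). -/
def sPath (Se : E → A) : List E → A
  | [] => 0
  | e :: es => es.foldl (fun a f => a * Se f) (Se e)

/-- The gap projection `P_v^H = P_v − ∑_{s(e) = v, r(e) ∉ H} S_e S_e*`. -/
noncomputable def gapProj (r s : E → V) (P : V → A) (Se : E → A) (H : Set V) (v : V)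
    (hfin : {e : E | s e = v ∧ r e ∉ H}.Finite) : A :=
  P v - ∑ e ∈ hfin.toFinset, Se e * star (Se e)

/-- The projections `Q_w`, for `w` a vertex of `Ē_{(H,S)}`:
`Q_w = P_w` for `w ∈ H`; `Q_w = P_w^H` for `w ∈ S`; `Q_α = S_α S_α*` for `α ∈ F₁`;
`Q_α = S_α P_{r(α)}^H S_α*` for `α ∈ F₂`. -/
noncomputable def QC (r s : E → V) (H S : Set V) (hS : S ⊆ breakingVertices r s H)
    (P : V → A) (Se : E → A) : BarV r s H S → A
  | .inl (.inl v) => P v.1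
  | .inl (.inr v) => gapProj r s P Se H v.1 ((hS v.2).2.1)
  | .inr (.inl p) => sPath Se p.1 * star (sPath Se p.1)
  | .inr (.inr p) => sPath Se p.1 *
      gapProj r s P Se H (r (p.1.getLast p.2.choose)) ((hS p.2.choose_spec.2).2.1) *
      star (sPath Se p.1)

/-- The partial isometries `T_f`, for `f` an edge of `Ē_{(H,S)}`:
`T_e = S_e` for `e ∈ E¹`; `T_ā = S_α` for `α ∈ F₁`; `T_ā = S_α P_{r(α)}^H` for `α ∈ F₂`. -/
noncomputable def TC (r s : E → V) (H S : Set V) (hS : S ⊆ breakingVertices r s H)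
    (P : V → A) (Se : E → A) : BarE r s H S → A
  | .inl (.inl e) => Se e.1
  | .inl (.inr e) => Se e.1
  | .inr (.inl p) => sPath Se p.1
  | .inr (.inr p) => sPath Se p.1 *
      gapProj r s P Se H (r (p.1.getLast p.2.choose)) ((hS p.2.choose_spec.2).2.1)

section

variable {r s : E → V} {H S : Set V} {P : V → A} {Se : E → A}

theorem not_mem_of_mem_breakingVertices (hH : Hereditary r s H) {v : V}
    (hv : v ∈ breakingVertices r s H) : v ∉ H := by
  obtain ⟨-, -, e, rfl, he⟩ := hv
  exact fun h => he (hH e h)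

theorem infinite_edges_into_of_mem_breakingVertices {v : V}
    (hv : v ∈ breakingVertices r s H) : {e : E | s e = v ∧ r e ∈ H}.Infinite := by
  intro hfin
  refine hv.1 ((hfin.union hv.2.1).subset fun e he => ?_)
  by_cases h : r e ∈ H
  · exact Or.inl ⟨he, h⟩
  · exact Or.inr ⟨he, h⟩

theorem sPath_cons_cons (Se : E → A) (e f : E) (l : List E) :
    sPath Se (e :: f :: l) = Se e * sPath Se (f :: l) := by
  have key : ∀ (l : List E) (x y : A),
      l.foldl (fun a f => a * Se f) (x * y) = x * l.foldl (fun a f => a * Se f) y := by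
    intro l
    induction l with
    | nil => intro x y; rfl
    | cons g l ih => intro x y; simp only [List.foldl_cons, mul_assoc, ih]
  exact key l _ _

/-- The relations of a Cuntz–Krieger family used for infinite graphs, without the summation
relation at regular vertices and with `S_e S_e* ≤ P_{s(e)}` replaced by `P_{s(e)} S_e = S_e`. -/
structure IsToeplitzFamily (r s : E → V) (P : V → A) (Se : E → A) : Prop where
  isStarProjection : ∀ v, IsStarProjection (P v)
  orthogonal : ∀ v w, v ≠ w → P v * P w = 0
  star_mul_of_ne : ∀ e f, e ≠ f → star (Se e) * Se f = 0
  star_mul_self : ∀ e, star (Se e) * Se e = P (r e)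
  source_mul : ∀ e, P (s e) * Se e = Se e

namespace IsToeplitzFamily

theorem mul_range (h : IsToeplitzFamily r s P Se) (e : E) : Se e * P (r e) = Se e := by
  have hP := (h.isStarProjection (r e)).isIdempotentElem.eq
  have hPs := (h.isStarProjection (r e)).isSelfAdjoint.star_eq
  rw [← sub_eq_zero, ← CStarRing.star_mul_self_eq_zero_iff]
  simp only [star_sub, star_mul, hPs, sub_mul, mul_sub]
  simp only [mul_assoc, h.star_mul_self]
  simp only [← mul_assoc, h.star_mul_self, hP, sub_self]

theorem mul_star_mul (h : IsToeplitzFamily r s P Se) (e : E) :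
    Se e * star (Se e) * Se e = Se e := by
  rw [mul_assoc, h.star_mul_self, h.mul_range]

theorem vertex_mul_edge_of_ne (h : IsToeplitzFamily r s P Se) {v : V} {e : E} (hv : v ≠ s e) :
    P v * Se e = 0 := by
  rw [← h.source_mul e, ← mul_assoc, h.orthogonal v _ hv, zero_mul]

variable {v : V} (hfin : {e : E | s e = v ∧ r e ∉ H}.Finite)

theorem vertex_mul_gapProj (h : IsToeplitzFamily r s P Se) :
    P v * gapProj r s P Se H v hfin = gapProj r s P Se H v hfin := by
  rw [gapProj, mul_sub, (h.isStarProjection v).isIdempotentElem.eq, Finset.mul_sum]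
  congr 1
  refine Finset.sum_congr rfl fun e he => ?_
  obtain ⟨rfl, -⟩ := hfin.mem_toFinset.1 he
  rw [← mul_assoc, h.source_mul]

theorem star_gapProj (h : IsToeplitzFamily r s P Se) :
    star (gapProj r s P Se H v hfin) = gapProj r s P Se H v hfin := by
  simp [gapProj, star_sub, star_sum, (h.isStarProjection v).isSelfAdjoint.star_eq]

theorem gapProj_mul_vertex (h : IsToeplitzFamily r s P Se) :
    gapProj r s P Se H v hfin * P v = gapProj r s P Se H v hfin := by
  simpa only [star_mul, h.star_gapProj hfin, (h.isStarProjection v).isSelfAdjoint.star_eq]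
    using congrArg star (h.vertex_mul_gapProj hfin)

theorem gapProj_mul_edge_of_ne (h : IsToeplitzFamily r s P Se) {e : E} (he : v ≠ s e) :
    gapProj r s P Se H v hfin * Se e = 0 := by
  rw [← h.gapProj_mul_vertex hfin, mul_assoc, h.vertex_mul_edge_of_ne he, mul_zero]

theorem gapProj_mul_edge_of_not_mem (h : IsToeplitzFamily r s P Se) {e : E} (he : r e ∉ H) :
    gapProj r s P Se H v hfin * Se e = 0 := by
  by_cases hv : v = s e
  · subst hv
    rw [gapProj, sub_mul, h.source_mul, Finset.sum_mul, Finset.sum_eq_single e,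
      h.mul_star_mul, sub_self]
    · intro f _ hf
      rw [mul_assoc, h.star_mul_of_ne f e hf, mul_zero]
    · intro hn
      exact absurd (hfin.mem_toFinset.2 ⟨rfl, he⟩) hn
  · exact h.gapProj_mul_edge_of_ne hfin hv

theorem gapProj_mul_edge_of_mem (h : IsToeplitzFamily r s P Se) {e : E} (hv : s e = v)
    (he : r e ∈ H) : gapProj r s P Se H v hfin * Se e = Se e := by
  subst hv
  rw [gapProj, sub_mul, h.source_mul, Finset.sum_mul, Finset.sum_eq_zero, sub_zero]
  intro f hf
  have hne : f ≠ e := by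
    rintro rfl
    exact (hfin.mem_toFinset.1 hf).2 he
  rw [mul_assoc, h.star_mul_of_ne f e hne, mul_zero]

theorem isStarProjection_gapProj (h : IsToeplitzFamily r s P Se) :
    IsStarProjection (gapProj r s P Se H v hfin) where
  isIdempotentElem := by
    rw [IsIdempotentElem]
    nth_rw 2 [gapProj]
    rw [mul_sub, h.gapProj_mul_vertex, Finset.mul_sum, Finset.sum_eq_zero, sub_zero]
    intro e he
    rw [← mul_assoc, h.gapProj_mul_edge_of_not_mem hfin (hfin.mem_toFinset.1 he).2, zero_mul]
  isSelfAdjoint := h.star_gapProj hfin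

theorem gapProj_mul_gapProj_of_ne (h : IsToeplitzFamily r s P Se) {w : V} (hvw : v ≠ w)
    (hfin' : {e : E | s e = w ∧ r e ∉ H}.Finite) :
    gapProj r s P Se H v hfin * gapProj r s P Se H w hfin' = 0 := by
  rw [← h.gapProj_mul_vertex hfin, ← h.vertex_mul_gapProj hfin', mul_assoc,
    ← mul_assoc (P v), h.orthogonal v w hvw, zero_mul, mul_zero]

theorem vertex_mul_gapProj_of_ne (h : IsToeplitzFamily r s P Se) {w : V} (hvw : w ≠ v) :
    P w * gapProj r s P Se H v hfin = 0 := by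
  rw [← h.vertex_mul_gapProj hfin, ← mul_assoc, h.orthogonal w v hvw, zero_mul]

end IsToeplitzFamily

/-- `IsBarIsometry r s H S hS P Se e l T Q` says that the path `α = e l` belongs to
`F₁(H,S) ∪ F₂(H,S)`, that `T = T_ā`, and that `Q = Q_{r(ā)}` is its initial projection. -/
inductive IsBarIsometry (r s : E → V) (H S : Set V) (hS : S ⊆ breakingVertices r s H)
    (P : V → A) (Se : E → A) : E → List E → A → A → Prop
  | edge (e : E) (hr : r e ∈ H) (hs : s e ∉ H ∪ S) :
      IsBarIsometry r s H S hS P Se e [] (Se e) (P (r e))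
  | gap (e : E) (hr : r e ∈ S) :
      IsBarIsometry r s H S hS P Se e [] (Se e * gapProj r s P Se H (r e) (hS hr).2.1)
        (gapProj r s P Se H (r e) (hS hr).2.1)
  | cons (e f : E) (l : List E) (T Q : A) (hef : r e = s f)
      (h : IsBarIsometry r s H S hS P Se f l T Q) :
      IsBarIsometry r s H S hS P Se e (f :: l) (Se e * T) Q

namespace IsBarIsometry

variable {hS : S ⊆ breakingVertices r s H} {e f : E} {l m : List E} {T U Q R : A}

theorem source_not_mem (hH : Hereditary r s H)
    (hT : IsBarIsometry r s H S hS P Se e l T Q) : s e ∉ H := by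
  induction hT with
  | edge e hr hs => exact fun h => hs (Or.inl h)
  | gap e hr => exact fun h => not_mem_of_mem_breakingVertices hH (hS hr) (hH e h)
  | cons e f l T Q hef _ ih => exact fun h => ih (hef ▸ hH e h)

theorem source_mul (h : IsToeplitzFamily r s P Se)
    (hT : IsBarIsometry r s H S hS P Se e l T Q) : P (s e) * T = T := by
  cases hT <;> simp only [← mul_assoc, h.source_mul]

theorem mul_initial (h : IsToeplitzFamily r s P Se)
    (hT : IsBarIsometry r s H S hS P Se e l T Q) : T * Q = T := by
  induction hT with
  | edge e hr hs => exact h.mul_range e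
  | gap e hr => rw [mul_assoc, (h.isStarProjection_gapProj _).isIdempotentElem.eq]
  | cons e f l T Q hef _ ih => rw [mul_assoc, ih]

theorem star_mul_self (h : IsToeplitzFamily r s P Se)
    (hT : IsBarIsometry r s H S hS P Se e l T Q) : star T * T = Q := by
  induction hT with
  | edge e hr hs => exact h.star_mul_self e
  | gap e hr =>
    rw [star_mul, mul_assoc, ← mul_assoc (star (Se e)), h.star_mul_self, h.vertex_mul_gapProj,
      h.star_gapProj, (h.isStarProjection_gapProj _).isIdempotentElem.eq]
  | cons e f l T Q hef hT ih =>
    rw [star_mul, mul_assoc, ← mul_assoc (star (Se e)), h.star_mul_self, hef, hT.source_mul h, ih]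

theorem vertex_mul (h : IsToeplitzFamily r s P Se) (hH : Hereditary r s H)
    (hT : IsBarIsometry r s H S hS P Se e l T Q) {v : V} (hv : v ∈ H) : P v * T = 0 := by
  have hne : v ≠ s e := fun hve => hT.source_not_mem hH (hve ▸ hv)
  rw [← hT.source_mul h, ← mul_assoc, h.orthogonal _ _ hne, zero_mul]

theorem gapProj_mul (h : IsToeplitzFamily r s P Se) (hH : Hereditary r s H)
    (hT : IsBarIsometry r s H S hS P Se e l T Q) {v : V} (hv : v ∈ S) :
    gapProj r s P Se H v (hS hv).2.1 * T = 0 := by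
  cases hT with
  | edge _ hr hs => exact h.gapProj_mul_edge_of_ne _ fun hve => hs (Or.inr (hve ▸ hv))
  | gap _ hr =>
    rw [← mul_assoc, h.gapProj_mul_edge_of_not_mem _
      (not_mem_of_mem_breakingVertices hH (hS hr)), zero_mul]
  | cons _ f l T _ hef hT =>
    rw [← mul_assoc, h.gapProj_mul_edge_of_not_mem _ (hef ▸ hT.source_not_mem hH), zero_mul]

theorem star_edge_mul_of_ne (h : IsToeplitzFamily r s P Se)
    (hT : IsBarIsometry r s H S hS P Se e l T Q) (hfe : f ≠ e) : star (Se f) * T = 0 := by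
  cases hT <;> simp only [← mul_assoc, h.star_mul_of_ne f e hfe, zero_mul]

theorem eq_edge_mul (h : IsToeplitzFamily r s P Se)
    (hT : IsBarIsometry r s H S hS P Se e l T Q) : ∃ x, T = Se e * x := by
  cases hT with
  | edge => exact ⟨_, (h.mul_range e).symm⟩
  | gap => exact ⟨_, rfl⟩
  | cons => exact ⟨_, rfl⟩

theorem star_nil_mul_cons (h : IsToeplitzFamily r s P Se) (hH : Hereditary r s H)
    (hT : IsBarIsometry r s H S hS P Se e [] T Q)
    (hU : IsBarIsometry r s H S hS P Se f m U R) :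
    star T * (Se e * U) = 0 := by
  cases hT with
  | edge _ hr hs => rw [← mul_assoc, h.star_mul_self, hU.vertex_mul h hH hr]
  | gap _ hr =>
    rw [star_mul, h.star_gapProj, mul_assoc, ← mul_assoc (star (Se e)), h.star_mul_self,
      ← h.gapProj_mul_vertex, mul_assoc, ← mul_assoc (P (r e)) (P (r e)),
      (h.isStarProjection (r e)).isIdempotentElem.eq, ← mul_assoc, h.gapProj_mul_vertex,
      hU.gapProj_mul h hH hr]

theorem star_mul_of_ne (h : IsToeplitzFamily r s P Se) (hH : Hereditary r s H)
    (hT : IsBarIsometry r s H S hS P Se e l T Q)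
    (hU : IsBarIsometry r s H S hS P Se f m U R) (hne : e :: l ≠ f :: m) :
    star T * U = 0 := by
  by_cases hef : e = f
  swap
  · obtain ⟨x, rfl⟩ := hT.eq_edge_mul h
    rw [star_mul, mul_assoc, hU.star_edge_mul_of_ne h hef, mul_zero]
  subst hef
  induction l generalizing e m T U with
  | nil =>
    cases hU with
    | edge | gap => exact absurd rfl hne
    | cons _ g m U _ heg hU => exact hT.star_nil_mul_cons h hH hU
  | cons a l ih =>
    cases hT with
    | cons _ _ _ T _ hea hT =>
    cases hU with
    | edge _ hr hs =>
      have := (IsBarIsometry.edge (hS := hS) (P := P) (Se := Se) e hr hs).star_nil_mul_cons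
        h hH hT
      simpa only [star_mul, star_star, star_zero] using congrArg star this
    | gap _ hr =>
      have := (IsBarIsometry.gap (hS := hS) (P := P) (Se := Se) e hr).star_nil_mul_cons
        h hH hT
      simpa only [star_mul, star_star, star_zero] using congrArg star this
    | cons _ g m U _ heg hU =>
      rw [star_mul, mul_assoc, ← mul_assoc (star (Se e)), h.star_mul_self, heg, hU.source_mul h]
      by_cases hag : a = g
      · subst hag
        exact ih hT hU fun hl => hne (congrArg _ hl)
      · obtain ⟨x, rfl⟩ := hT.eq_edge_mul h
        rw [star_mul, mul_assoc, hU.star_edge_mul_of_ne h hag, mul_zero]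

end IsBarIsometry

theorem exists_isBarIsometry_of_mem_F1 (hS : S ⊆ breakingVertices r s H) {p : List E}
    (hp : p ∈ F1 r s H S) : ∃ e l, p = e :: l ∧
      IsBarIsometry r s H S hS P Se e l (sPath Se p) (P (r (p.getLast hp.choose))) := by
  obtain ⟨hne, hc, hr, hs⟩ := hp
  cases p with
  | nil => exact absurd rfl hne
  | cons e l =>
    refine ⟨e, l, rfl, ?_⟩
    induction l generalizing e with
    | nil => exact .edge e hr hs
    | cons f l ih =>
      rw [sPath_cons_cons]
      have hc' := List.isChain_cons_cons.1 hc
      exact .cons e f l _ _ hc'.1 (ih f (by simp) hc'.2 hr hs)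

theorem exists_isBarIsometry_of_mem_F2 (hS : S ⊆ breakingVertices r s H) {p : List E}
    (hp : p ∈ F2 r s H S) : ∃ e l, p = e :: l ∧
      IsBarIsometry r s H S hS P Se e l
        (sPath Se p * gapProj r s P Se H (r (p.getLast hp.choose)) (hS hp.choose_spec.2).2.1)
        (gapProj r s P Se H (r (p.getLast hp.choose)) (hS hp.choose_spec.2).2.1) := by
  obtain ⟨hne, hc, hr⟩ := hp
  cases p with
  | nil => exact absurd rfl hne
  | cons e l =>
    refine ⟨e, l, rfl, ?_⟩
    induction l generalizing e with
    | nil => exact .gap e hr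
    | cons f l ih =>
      rw [sPath_cons_cons, mul_assoc]
      have hc' := List.isChain_cons_cons.1 hc
      exact .cons e f l _ _ hc'.1 (ih f (by simp) hc'.2 hr)

/-- The path underlying a vertex of `Ē_{(H,S)}` in `F₁(H,S) ⊔ F₂(H,S)`. -/
def barPath : {p : List E // p ∈ F1 r s H S} ⊕ {p : List E // p ∈ F2 r s H S} → List E
  | .inl p => p.1
  | .inr p => p.1

theorem barPath_injective (hH : Hereditary r s H) (hS : S ⊆ breakingVertices r s H) :
    Function.Injective (barPath (r := r) (s := s) (H := H) (S := S)) := by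
  have key : ∀ p, p ∈ F1 r s H S → p ∉ F2 r s H S := fun p h1 h2 =>
    not_mem_of_mem_breakingVertices hH (hS h2.choose_spec.2) h1.choose_spec.2.1
  rintro (⟨p, hp⟩ | ⟨p, hp⟩) (⟨q, hq⟩ | ⟨q, hq⟩) (rfl : p = q)
  · rfl
  · exact absurd hq (key p hp)
  · exact absurd hp (key p hq)
  · rfl

variable (hS : S ⊆ breakingVertices r s H)

theorem exists_isBarIsometry (hH : Hereditary r s H)
    (p : {p : List E // p ∈ F1 r s H S} ⊕ {p : List E // p ∈ F2 r s H S}) :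
    ∃ e l, barPath p = e :: l ∧ IsBarIsometry r s H S hS P Se e l
      (TC r s H S hS P Se (.inr p)) (QC r s H S hS P Se (barR r s H S hH (.inr p))) := by
  rcases p with p | p
  · exact exists_isBarIsometry_of_mem_F1 hS p.2
  · exact exists_isBarIsometry_of_mem_F2 hS p.2

namespace IsToeplitzFamily

theorem QC_inr (h : IsToeplitzFamily r s P Se)
    (p : {p : List E // p ∈ F1 r s H S} ⊕ {p : List E // p ∈ F2 r s H S}) :
    QC r s H S hS P Se (.inr p) =
      TC r s H S hS P Se (.inr p) * star (TC r s H S hS P Se (.inr p)) := by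
  rcases p with p | p
  · rfl
  · simp only [QC, TC, star_mul, h.star_gapProj]
    rw [← mul_assoc, mul_assoc (sPath Se p.1) _ (gapProj r s P Se H _ _),
      (h.isStarProjection_gapProj _).isIdempotentElem.eq]

theorem TC_inr_mul_star_mul (h : IsToeplitzFamily r s P Se) (hH : Hereditary r s H)
    (p : {p : List E // p ∈ F1 r s H S} ⊕ {p : List E // p ∈ F2 r s H S}) :
    TC r s H S hS P Se (.inr p) * star (TC r s H S hS P Se (.inr p)) *
      TC r s H S hS P Se (.inr p) = TC r s H S hS P Se (.inr p) := by
  obtain ⟨e, l, -, hT⟩ := exists_isBarIsometry (P := P) (Se := Se) hS hH p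
  rw [mul_assoc, hT.star_mul_self h, hT.mul_initial h]

theorem TC_mul_star_mul (h : IsToeplitzFamily r s P Se) (hH : Hereditary r s H)
    (f : BarE r s H S) :
    TC r s H S hS P Se f * star (TC r s H S hS P Se f) * TC r s H S hS P Se f =
      TC r s H S hS P Se f := by
  rcases f with (f | f) | p
  · exact h.mul_star_mul f.1
  · exact h.mul_star_mul f.1
  · exact h.TC_inr_mul_star_mul hS hH p

theorem isStarProjection_QC (h : IsToeplitzFamily r s P Se) (hH : Hereditary r s H)
    (w : BarV r s H S) : IsStarProjection (QC r s H S hS P Se w) := by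
  rcases w with (v | v) | p
  · exact h.isStarProjection v.1
  · exact h.isStarProjection_gapProj _
  · rw [h.QC_inr hS p]
    refine ⟨?_, .mul_star_self _⟩
    rw [IsIdempotentElem, ← mul_assoc, h.TC_inr_mul_star_mul hS hH]

theorem QC_inl_mul_TC_inr (h : IsToeplitzFamily r s P Se) (hH : Hereditary r s H)
    (v : {v : V // v ∈ H} ⊕ {v : V // v ∈ S})
    (p : {p : List E // p ∈ F1 r s H S} ⊕ {p : List E // p ∈ F2 r s H S}) :
    QC r s H S hS P Se (.inl v) * TC r s H S hS P Se (.inr p) = 0 := by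
  obtain ⟨e, l, -, hT⟩ := exists_isBarIsometry (P := P) (Se := Se) hS hH p
  rcases v with v | v
  · exact hT.vertex_mul h hH v.2
  · exact hT.gapProj_mul h hH v.2

theorem QC_inl_mul_QC_inr (h : IsToeplitzFamily r s P Se) (hH : Hereditary r s H)
    (v : {v : V // v ∈ H} ⊕ {v : V // v ∈ S})
    (p : {p : List E // p ∈ F1 r s H S} ⊕ {p : List E // p ∈ F2 r s H S}) :
    QC r s H S hS P Se (.inl v) * QC r s H S hS P Se (.inr p) = 0 := by
  rw [h.QC_inr, ← mul_assoc, h.QC_inl_mul_TC_inr hS hH, zero_mul]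

theorem QC_mul_symm (h : IsToeplitzFamily r s P Se) (hH : Hereditary r s H)
    {w w' : BarV r s H S} (hw : QC r s H S hS P Se w * QC r s H S hS P Se w' = 0) :
    QC r s H S hS P Se w' * QC r s H S hS P Se w = 0 := by
  simpa only [star_mul, (h.isStarProjection_QC hS hH _).isSelfAdjoint.star_eq, star_zero]
    using congrArg star hw

theorem QC_mul_QC_of_ne (h : IsToeplitzFamily r s P Se) (hH : Hereditary r s H)
    {w w' : BarV r s H S} (hne : w ≠ w') :
    QC r s H S hS P Se w * QC r s H S hS P Se w' = 0 := by
  have hHS : ∀ (v : {v : V // v ∈ H}) (u : {v : V // v ∈ S}),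
      QC r s H S hS P Se (.inl (.inl v)) * QC r s H S hS P Se (.inl (.inr u)) = 0 :=
    fun v u => h.vertex_mul_gapProj_of_ne _ fun hvu =>
      not_mem_of_mem_breakingVertices hH (hS u.2) (hvu ▸ v.2)
  rcases w with (v | v) | p <;> rcases w' with (u | u) | q
  · exact h.orthogonal _ _ fun huv => hne (by rw [Subtype.ext huv])
  · exact hHS v u
  · exact h.QC_inl_mul_QC_inr hS hH _ q
  · exact h.QC_mul_symm hS hH (hHS u v)
  · exact h.gapProj_mul_gapProj_of_ne _ (fun huv => hne (by rw [Subtype.ext huv])) _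
  · exact h.QC_inl_mul_QC_inr hS hH _ q
  · exact h.QC_mul_symm hS hH (h.QC_inl_mul_QC_inr hS hH _ p)
  · exact h.QC_mul_symm hS hH (h.QC_inl_mul_QC_inr hS hH _ p)
  · obtain ⟨e, l, hp, hT⟩ := exists_isBarIsometry (P := P) (Se := Se) hS hH p
    obtain ⟨f, m, hq, hU⟩ := exists_isBarIsometry (P := P) (Se := Se) hS hH q
    have hpq : e :: l ≠ f :: m := by
      rw [← hp, ← hq]
      exact fun hb => hne (congrArg _ (barPath_injective hH hS hb))
    rw [h.QC_inr, h.QC_inr, mul_assoc, ← mul_assoc (star _), hT.star_mul_of_ne h hH hU hpq,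
      zero_mul, mul_zero]

theorem QC_barS_mul_TC (h : IsToeplitzFamily r s P Se) (hH : Hereditary r s H)
    (f : BarE r s H S) :
    QC r s H S hS P Se (barS r s H S f) * TC r s H S hS P Se f = TC r s H S hS P Se f := by
  rcases f with (f | f) | p
  · exact h.source_mul f.1
  · exact h.gapProj_mul_edge_of_mem _ rfl f.2.2
  · have hb : barS r s H S (.inr p) = .inr p := by rcases p with p | p <;> rfl
    rw [hb, h.QC_inr, h.TC_inr_mul_star_mul hS hH]

theorem star_TC_mul_TC_of_ne (h : IsToeplitzFamily r s P Se) (hH : Hereditary r s H)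
    {f g : BarE r s H S} (hne : f ≠ g) :
    star (TC r s H S hS P Se f) * TC r s H S hS P Se g = 0 := by
  by_cases hfg : barS r s H S f = barS r s H S g
  · rcases f with (f | f) | f | f <;> rcases g with (g | g) | g | g <;>
      simp only [barS, Sum.inl.injEq, Sum.inr.injEq, reduceCtorEq] at hfg
    · exact h.star_mul_of_ne _ _ fun he => hne (by rw [Subtype.ext he])
    · exact h.star_mul_of_ne _ _ fun he => hne (by rw [Subtype.ext he])
    · exact absurd (by rw [hfg]) hne
    · exact absurd (by rw [hfg]) hne
  · rw [← h.QC_barS_mul_TC hS hH f, ← h.QC_barS_mul_TC hS hH g, star_mul,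
      (h.isStarProjection_QC hS hH _).isSelfAdjoint.star_eq, mul_assoc,
      ← mul_assoc (QC r s H S hS P Se _), h.QC_mul_QC_of_ne hS hH hfg, zero_mul, mul_zero]

theorem star_TC_mul_self (h : IsToeplitzFamily r s P Se) (hH : Hereditary r s H)
    (f : BarE r s H S) : star (TC r s H S hS P Se f) * TC r s H S hS P Se f =
      QC r s H S hS P Se (barR r s H S hH f) := by
  rcases f with (f | f) | p
  · exact h.star_mul_self f.1
  · exact h.star_mul_self f.1
  · obtain ⟨e, l, -, hT⟩ := exists_isBarIsometry (P := P) (Se := Se) hS hH p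
    exact hT.star_mul_self h

theorem TC_mul_star_le [PartialOrder A] [StarOrderedRing A] (h : IsToeplitzFamily r s P Se)
    (hH : Hereditary r s H) (f : BarE r s H S) :
    TC r s H S hS P Se f * star (TC r s H S hS P Se f) ≤
      QC r s H S hS P Se (barS r s H S f) := by
  have hp : IsStarProjection (TC r s H S hS P Se f * star (TC r s H S hS P Se f)) :=
    ⟨by rw [IsIdempotentElem, ← mul_assoc, h.TC_mul_star_mul hS hH], .mul_star_self _⟩
  rw [hp.le_iff_mul_eq_right (h.isStarProjection_QC hS hH _), ← mul_assoc,
    h.QC_barS_mul_TC hS hH]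

end IsToeplitzFamily

theorem barS_fiber_infinite (hS : S ⊆ breakingVertices r s H) {v : V} (hv : v ∈ S) :
    {f : BarE r s H S | barS r s H S f = .inl (.inr ⟨v, hv⟩)}.Infinite := by
  have := (infinite_edges_into_of_mem_breakingVertices (hS hv)).to_subtype
  let φ : {e : E | s e = v ∧ r e ∈ H} → BarE r s H S :=
    fun e => .inl (.inr ⟨e.1, e.2.1.symm ▸ hv, e.2.2⟩)
  have hφ : Function.Injective φ := by
    intro e f hef
    simpa [φ, Subtype.ext_iff] using hef
  refine (Set.infinite_range_of_injective hφ).mono ?_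
  rintro _ ⟨⟨e, rfl, he⟩, rfl⟩
  rfl

theorem QC_eq_sum (h : IsToeplitzFamily r s P Se)
    (hP : ∀ v : V, ∀ hfin : (s ⁻¹' {v}).Finite, (s ⁻¹' {v}).Nonempty →
      P v = ∑ e ∈ hfin.toFinset, Se e * star (Se e))
    (w : BarV r s H S) (hfin : {f : BarE r s H S | barS r s H S f = w}.Finite)
    (hne : {f : BarE r s H S | barS r s H S f = w}.Nonempty) :
    QC r s H S hS P Se w =
      ∑ f ∈ hfin.toFinset, TC r s H S hS P Se f * star (TC r s H S hS P Se f) := by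
  rcases w with (⟨v, hv⟩ | v) | p
  · have hmem : ∀ f : BarE r s H S, barS r s H S f = .inl (.inl ⟨v, hv⟩) →
        ∃ (e : E) (he : s e ∈ H), f = .inl (.inl ⟨e, he⟩) ∧ s e = v := by
      rintro ((⟨e, he⟩ | e) | e | e) hf <;>
        simp only [barS, Sum.inl.injEq, Subtype.mk.injEq, reduceCtorEq] at hf
      exact ⟨e, he, rfl, hf⟩
    have hset : s ⁻¹' {v} = (fun e : {e : E // s e ∈ H} => e.1) ''
        ((fun e => (.inl (.inl e) : BarE r s H S)) ⁻¹'
          {f : BarE r s H S | barS r s H S f = .inl (.inl ⟨v, hv⟩)}) := by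
      ext e
      constructor
      · rintro rfl
        exact ⟨⟨e, hv⟩, rfl, rfl⟩
      · rintro ⟨e, he, rfl⟩
        simpa [barS] using he
    have hfin' : (s ⁻¹' {v}).Finite := by
      rw [hset]
      exact (hfin.preimage (Sum.inl_injective.comp Sum.inl_injective).injOn).image _
    have hne' : (s ⁻¹' {v}).Nonempty := by
      obtain ⟨f, hf⟩ := hne
      obtain ⟨e, -, -, he⟩ := hmem f hf
      exact ⟨e, he⟩
    change P v = _
    rw [hP v hfin' hne']
    refine Finset.sum_bij (fun e he => .inl (.inl ⟨e, ?_⟩)) ?_ ?_ ?_ ?_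
    · rw [hfin'.mem_toFinset] at he
      exact (show s e = v from he) ▸ hv
    · intro e he
      rw [hfin'.mem_toFinset] at he
      obtain rfl : s e = v := he
      exact hfin.mem_toFinset.2 rfl
    · intro e _ f _ hef
      simpa using hef
    · intro f hf
      obtain ⟨e, he, rfl, hev⟩ := hmem f (hfin.mem_toFinset.1 hf)
      exact ⟨e, hfin'.mem_toFinset.2 hev, rfl⟩
    · intro e _
      rfl
  · exact absurd hfin (barS_fiber_infinite hS v.2)
  · have hset : hfin.toFinset = {.inr p} := by
      ext f
      rw [hfin.mem_toFinset, Finset.mem_singleton]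
      rcases f with (f | f) | f | f <;> rcases p with p | p <;> simp [barS]
    rw [hset, Finset.sum_singleton, h.QC_inr]

end

/-- If `{P_v, S_e}` is a Cuntz–Krieger `E`-family in a complex
C*-algebra `A`, `H` is saturated hereditary and `S ⊆ B_H`, then the family
`{Q_w, T_f}` defined above is a Cuntz–Krieger `Ē_{(H,S)}`-family in `A`. -/
theorem QT_is_CuntzKrieger_bar_family
    (r s : E → V) (H S : Set V) (hH : Hereditary r s H) (hSat : Saturated r s H)
    (hS : S ⊆ breakingVertices r s H)
    [PartialOrder A] [StarOrderedRing A]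
    (P : V → A) (Se : E → A)
    -- `{P_v}` are mutually orthogonal projections
    (hPstar : ∀ v : V, star (P v) = P v)
    (hPidem : ∀ v : V, P v * P v = P v)
    (hPorth : ∀ v w : V, v ≠ w → P v * P w = 0)
    -- the `S_e` are partial isometries with mutually orthogonal ranges
    (hPI : ∀ e : E, Se e * star (Se e) * Se e = Se e)
    (horth : ∀ e f : E, e ≠ f → star (Se e) * Se f = 0)
    -- Cuntz–Krieger relations for `{P_v, S_e}`
    (hCK1 : ∀ e : E, star (Se e) * Se e = P (r e))
    (hCK2 : ∀ e : E, Se e * star (Se e) ≤ P (s e))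
    (hCK3 : ∀ v : V, ∀ hfin : (s ⁻¹' {v}).Finite, (s ⁻¹' {v}).Nonempty →
      P v = ∑ e ∈ hfin.toFinset, Se e * star (Se e)) :
    -- the `Q_w` are mutually orthogonal projections
    (∀ w : BarV r s H S, star (QC r s H S hS P Se w) = QC r s H S hS P Se w) ∧
    (∀ w : BarV r s H S, QC r s H S hS P Se w * QC r s H S hS P Se w =
        QC r s H S hS P Se w) ∧
    (∀ w w' : BarV r s H S, w ≠ w' →
        QC r s H S hS P Se w * QC r s H S hS P Se w' = 0) ∧
    -- the `T_f` are partial isometries with mutually orthogonal ranges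
    (∀ f : BarE r s H S, TC r s H S hS P Se f * star (TC r s H S hS P Se f) *
        TC r s H S hS P Se f = TC r s H S hS P Se f) ∧
    (∀ f g : BarE r s H S, f ≠ g →
        star (TC r s H S hS P Se f) * TC r s H S hS P Se g = 0) ∧
    -- Cuntz–Krieger relations for `{Q_w, T_f}` with respect to `Ē_{(H,S)}`
    (∀ f : BarE r s H S, star (TC r s H S hS P Se f) * TC r s H S hS P Se f =
        QC r s H S hS P Se (barR r s H S hH f)) ∧
    (∀ f : BarE r s H S, TC r s H S hS P Se f * star (TC r s H S hS P Se f) ≤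
        QC r s H S hS P Se (barS r s H S f)) ∧
    (∀ w : BarV r s H S, ∀ hfin : {f : BarE r s H S | barS r s H S f = w}.Finite,
        {f : BarE r s H S | barS r s H S f = w}.Nonempty →
        QC r s H S hS P Se w =
          ∑ f ∈ hfin.toFinset, TC r s H S hS P Se f * star (TC r s H S hS P Se f)) := by
  have hproj : ∀ v, IsStarProjection (P v) := fun v => ⟨hPidem v, hPstar v⟩
  have h : IsToeplitzFamily r s P Se :=
    { isStarProjection := hproj
      orthogonal := hPorth
      star_mul_of_ne := horth
      star_mul_self := hCK1
      source_mul := fun e => by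
        have hq : IsStarProjection (Se e * star (Se e)) :=
          ⟨by rw [IsIdempotentElem, ← mul_assoc, hPI], .mul_star_self _⟩
        have hle := (hq.le_iff_mul_eq_right (hproj (s e))).1 (hCK2 e)
        rw [← hPI e, ← mul_assoc, hle] }
  exact ⟨fun w => (h.isStarProjection_QC hS hH w).isSelfAdjoint.star_eq,
    fun w => (h.isStarProjection_QC hS hH w).isIdempotentElem.eq,
    fun _ _ => h.QC_mul_QC_of_ne hS hH, h.TC_mul_star_mul hS hH,
    fun _ _ => h.star_TC_mul_TC_of_ne hS hH, h.star_TC_mul_self hS hH,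
    h.TC_mul_star_le hS hH, QC_eq_sum hS h hCK3⟩

end CStar

end GraphIdeals
end

section
/- Let E = (E⁰, E¹, r, s) be a directed graph, K a field, H ⊆ E⁰ a saturated hereditary subset, and S ⊆ B_H. Let I_{(H,S)} be the two-sided ideal of the Leavitt path algebra L_K(E) generated by {v : v ∈ H} ∪ {v^H : v ∈ S}. Then I_{(H,S)} equals the K-linear span of the set {αβ* : α, β paths in E (including vertices, i.e. paths of length 0) with r(α) = r(β) ∈ H} ∪ {α v^H β* : α, β paths in E with r(α) = r(β) = v ∈ S}. -/
namespace GraphIdeals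

variable {V E : Type*}

section LPA

variable (K : Type*) [Field K]

/-- Generators of the Leavitt path algebra: a vertex `v`, a real edge `e`,
or a ghost edge `e*`. -/
abbrev LGen (V E : Type*) : Type _ := V ⊕ E ⊕ E

/-- The defining relations of the Leavitt path algebra of the graph
`(V, E, r, s)` with coefficients in `K`, imposed on the free associative
`K`-algebra on the generators `LGen V E`. -/
inductive LRel (r s : E → V) :
    FreeAlgebra K (LGen V E) → FreeAlgebra K (LGen V E) → Prop
  | vertOrth {v w : V} (h : v ≠ w) :
      LRel r s (FreeAlgebra.ι K (Sum.inl v : LGen V E) *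
        FreeAlgebra.ι K (Sum.inl w : LGen V E)) 0
  | vertIdem (v : V) :
      LRel r s (FreeAlgebra.ι K (Sum.inl v : LGen V E) *
        FreeAlgebra.ι K (Sum.inl v : LGen V E))
        (FreeAlgebra.ι K (Sum.inl v : LGen V E))
  | srcMul (e : E) :
      LRel r s (FreeAlgebra.ι K (Sum.inl (s e) : LGen V E) *
        FreeAlgebra.ι K (Sum.inr (Sum.inl e) : LGen V E))
        (FreeAlgebra.ι K (Sum.inr (Sum.inl e) : LGen V E))
  | mulRng (e : E) :
      LRel r s (FreeAlgebra.ι K (Sum.inr (Sum.inl e) : LGen V E) *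
        FreeAlgebra.ι K (Sum.inl (r e) : LGen V E))
        (FreeAlgebra.ι K (Sum.inr (Sum.inl e) : LGen V E))
  | rngMulStar (e : E) :
      LRel r s (FreeAlgebra.ι K (Sum.inl (r e) : LGen V E) *
        FreeAlgebra.ι K (Sum.inr (Sum.inr e) : LGen V E))
        (FreeAlgebra.ι K (Sum.inr (Sum.inr e) : LGen V E))
  | starMulSrc (e : E) :
      LRel r s (FreeAlgebra.ι K (Sum.inr (Sum.inr e) : LGen V E) *
        FreeAlgebra.ι K (Sum.inl (s e) : LGen V E))
        (FreeAlgebra.ι K (Sum.inr (Sum.inr e) : LGen V E))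
  | ck1Orth {e f : E} (h : e ≠ f) :
      LRel r s (FreeAlgebra.ι K (Sum.inr (Sum.inr e) : LGen V E) *
        FreeAlgebra.ι K (Sum.inr (Sum.inl f) : LGen V E)) 0
  | ck1 (e : E) :
      LRel r s (FreeAlgebra.ι K (Sum.inr (Sum.inr e) : LGen V E) *
        FreeAlgebra.ι K (Sum.inr (Sum.inl e) : LGen V E))
        (FreeAlgebra.ι K (Sum.inl (r e) : LGen V E))
  | ck2 (v : V) (hfin : (s ⁻¹' {v}).Finite) (hne : (s ⁻¹' {v}).Nonempty) :
      LRel r s (FreeAlgebra.ι K (Sum.inl v : LGen V E))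
        (∑ e ∈ hfin.toFinset,
          FreeAlgebra.ι K (Sum.inr (Sum.inl e) : LGen V E) *
          FreeAlgebra.ι K (Sum.inr (Sum.inr e) : LGen V E))

/-- The (unitalized) Leavitt path algebra: the quotient of the free associative
`K`-algebra on the generators by the Leavitt relations.  The Leavitt path algebra
proper is the non-unital subalgebra generated by the images of the generators; see
`LPAvert`, `LPAedge`, `LPAghost`. -/
abbrev LPA (r s : E → V) : Type _ := RingQuot (LRel K r s)

/-- The vertex idempotent `v` in the Leavitt path algebra. -/
def vert (r s : E → V) (v : V) : LPA K r s :=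
  RingQuot.mkAlgHom K (LRel K r s) (FreeAlgebra.ι K (Sum.inl v : LGen V E))

/-- The real edge `e` in the Leavitt path algebra. -/
def edge (r s : E → V) (e : E) : LPA K r s :=
  RingQuot.mkAlgHom K (LRel K r s) (FreeAlgebra.ι K (Sum.inr (Sum.inl e) : LGen V E))

/-- The ghost edge `e*` in the Leavitt path algebra. -/
def ghost (r s : E → V) (e : E) : LPA K r s :=
  RingQuot.mkAlgHom K (LRel K r s) (FreeAlgebra.ι K (Sum.inr (Sum.inr e) : LGen V E))

/-- `RangedPath r s p v` : `p` is a path (possibly of length `0`) with range `v`;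
a path of length `0` is a vertex. -/
def RangedPath (r s : E → V) (p : List E) (v : V) : Prop :=
  p.Chain' (pathRel r s) ∧ ∀ h : p ≠ [], r (p.getLast h) = v

/-- The monomial `α` in the Leavitt path algebra associated to a path `α` with
range `v`: the product of the edges of `α`, or the idempotent `v` if `α` has
length `0`. -/
def pathE (r s : E → V) (p : List E) (v : V) : LPA K r s :=
  if p.isEmpty then vert K r s v else (p.map (edge K r s)).prod

/-- The monomial `α*` in the Leavitt path algebra associated to a path `α` with
range `v`: the product of the ghost edges of `α` in reverse order, or the
idempotent `v` if `α` has length `0`. -/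
def pathStarE (r s : E → V) (p : List E) (v : V) : LPA K r s :=
  if p.isEmpty then vert K r s v else (p.reverse.map (ghost K r s)).prod

/-- The gap idempotent `v^H = v − ∑_{s(e) = v, r(e) ∉ H} e e*`. -/
noncomputable def gapL (r s : E → V) (H : Set V) (v : V)
    (hfin : {e : E | s e = v ∧ r e ∉ H}.Finite) : LPA K r s :=
  vert K r s v - ∑ e ∈ hfin.toFinset, edge K r s e * ghost K r s e

/-- The generating set `{v : v ∈ H} ∪ {v^H : v ∈ S}` of the ideal `I_{(H,S)}`. -/
def idealGens (r s : E → V) (H S : Set V) (hS : S ⊆ breakingVertices r s H) :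
    Set (LPA K r s) :=
  (vert K r s '' H) ∪
    {x | ∃ v : V, ∃ hv : v ∈ S, x = gapL K r s H v ((hS hv).2.1)}

section Relations

variable {K} (r s : E → V)

theorem vert_mul_vert_of_ne {v w : V} (h : v ≠ w) : vert K r s v * vert K r s w = 0 := by
  simpa [vert] using RingQuot.mkAlgHom_rel K (LRel.vertOrth (K := K) (r := r) (s := s) h)

theorem vert_mul_self (v : V) : vert K r s v * vert K r s v = vert K r s v := by
  simpa [vert] using RingQuot.mkAlgHom_rel K (LRel.vertIdem (K := K) (r := r) (s := s) v)

theorem vert_mul_edge (e : E) : vert K r s (s e) * edge K r s e = edge K r s e := by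
  simpa [vert, edge] using RingQuot.mkAlgHom_rel K (LRel.srcMul (K := K) (r := r) (s := s) e)

theorem edge_mul_vert (e : E) : edge K r s e * vert K r s (r e) = edge K r s e := by
  simpa [vert, edge] using RingQuot.mkAlgHom_rel K (LRel.mulRng (K := K) (r := r) (s := s) e)

theorem vert_mul_ghost (e : E) : vert K r s (r e) * ghost K r s e = ghost K r s e := by
  simpa [vert, ghost] using
    RingQuot.mkAlgHom_rel K (LRel.rngMulStar (K := K) (r := r) (s := s) e)

theorem ghost_mul_vert (e : E) : ghost K r s e * vert K r s (s e) = ghost K r s e := by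
  simpa [vert, ghost] using
    RingQuot.mkAlgHom_rel K (LRel.starMulSrc (K := K) (r := r) (s := s) e)

theorem ghost_mul_edge_of_ne {e f : E} (h : e ≠ f) : ghost K r s e * edge K r s f = 0 := by
  simpa [edge, ghost] using RingQuot.mkAlgHom_rel K (LRel.ck1Orth (K := K) (r := r) (s := s) h)

theorem ghost_mul_edge_self (e : E) : ghost K r s e * edge K r s e = vert K r s (r e) := by
  simpa [vert, edge, ghost] using
    RingQuot.mkAlgHom_rel K (LRel.ck1 (K := K) (r := r) (s := s) e)

theorem vert_eq_sum_edge_mul_ghost (v : V) (hfin : (s ⁻¹' {v}).Finite)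
    (hne : (s ⁻¹' {v}).Nonempty) :
    vert K r s v = ∑ e ∈ hfin.toFinset, edge K r s e * ghost K r s e := by
  simpa [vert, edge, ghost] using
    RingQuot.mkAlgHom_rel K (LRel.ck2 (K := K) (r := r) (s := s) v hfin hne)

/-- A subspace stable under left multiplication by all vertices, edges and ghost edges is stable
under left multiplication by the whole algebra. -/
theorem mul_mem_of_generators (N : Submodule K (LPA K r s))
    (hv : ∀ v, ∀ x ∈ N, vert K r s v * x ∈ N) (he : ∀ e, ∀ x ∈ N, edge K r s e * x ∈ N)
    (hg : ∀ e, ∀ x ∈ N, ghost K r s e * x ∈ N) (a : LPA K r s) :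
    ∀ x ∈ N, a * x ∈ N := by
  obtain ⟨a, rfl⟩ := RingQuot.mkAlgHom_surjective K (LRel K r s) a
  induction a using FreeAlgebra.induction with
  | grade0 c =>
    intro x hx
    rw [AlgHom.commutes, ← Algebra.smul_def]
    exact N.smul_mem c hx
  | grade1 g =>
    rcases g with v | e | e
    exacts [hv v, he e, hg e]
  | mul a b ha hb =>
    intro x hx
    rw [map_mul, mul_assoc]
    exact ha _ (hb _ hx)
  | add a b ha hb =>
    intro x hx
    rw [map_add, add_mul]
    exact N.add_mem (ha _ hx) (hb _ hx)

end Relations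

section Involution

variable (r s : E → V)

/-- The canonical anti-automorphism exchanging edges and ghost edges, as a homomorphism to
the opposite algebra. -/
noncomputable def involutionHom : LPA K r s →ₐ[K] (LPA K r s)ᵐᵒᵖ :=
  RingQuot.liftAlgHom K ⟨FreeAlgebra.lift K (Sum.elim (fun v => MulOpposite.op (vert K r s v))
    (Sum.elim (fun e => MulOpposite.op (ghost K r s e))
      (fun e => MulOpposite.op (edge K r s e)))), by
    intro a b h
    induction h with
    | vertOrth h => simp [← MulOpposite.op_mul, vert_mul_vert_of_ne r s h.symm]
    | vertIdem v => simp [← MulOpposite.op_mul, vert_mul_self]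
    | srcMul e => simp [← MulOpposite.op_mul, ghost_mul_vert]
    | mulRng e => simp [← MulOpposite.op_mul, vert_mul_ghost]
    | rngMulStar e => simp [← MulOpposite.op_mul, edge_mul_vert]
    | starMulSrc e => simp [← MulOpposite.op_mul, vert_mul_edge]
    | ck1Orth h => simp [← MulOpposite.op_mul, ghost_mul_edge_of_ne r s h.symm]
    | ck1 e => simp [← MulOpposite.op_mul, ghost_mul_edge_self]
    | ck2 v hfin hne =>
      simp only [map_sum, map_mul, FreeAlgebra.lift_ι_apply, Sum.elim_inl, Sum.elim_inr,
        ← MulOpposite.op_mul]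
      rw [vert_eq_sum_edge_mul_ghost r s v hfin hne]
      exact map_sum MulOpposite.opAddEquiv _ _⟩

/-- The canonical involution exchanging edges and ghost edges. -/
noncomputable def involution : LPA K r s →ₗ[K] LPA K r s :=
  (MulOpposite.opLinearEquiv K).symm.toLinearMap ∘ₗ (involutionHom K r s).toLinearMap

variable {K}

theorem involution_mul (x y : LPA K r s) :
    involution K r s (x * y) = involution K r s y * involution K r s x := by
  simp [involution]

@[simp]
theorem involution_vert (v : V) : involution K r s (vert K r s v) = vert K r s v := by
  simp [involution, involutionHom, vert]

@[simp]
theorem involution_edge (e : E) : involution K r s (edge K r s e) = ghost K r s e := by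
  simp [involution, involutionHom, edge]

@[simp]
theorem involution_ghost (e : E) : involution K r s (ghost K r s e) = edge K r s e := by
  simp [involution, involutionHom, ghost]

theorem involution_algebraMap (c : K) :
    involution K r s (algebraMap K _ c) = algebraMap K _ c := by
  simp [involution]

@[simp]
theorem involution_involution (x : LPA K r s) : involution K r s (involution K r s x) = x := by
  obtain ⟨x, rfl⟩ := RingQuot.mkAlgHom_surjective K (LRel K r s) x
  induction x using FreeAlgebra.induction with
  | grade0 c => simp only [AlgHom.commutes, involution_algebraMap]
  | grade1 g =>
    rcases g with v | e | e
    · change involution K r s (involution K r s (vert K r s v)) = vert K r s v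
      simp
    · change involution K r s (involution K r s (edge K r s e)) = edge K r s e
      simp
    · change involution K r s (involution K r s (ghost K r s e)) = ghost K r s e
      simp
  | mul a b ha hb => rw [map_mul, involution_mul, involution_mul, ha, hb]
  | add a b ha hb => rw [map_add, map_add, map_add, ha, hb]

theorem involution_prod_map_edge (p : List E) :
    p ≠ [] → involution K r s (p.map (edge K r s)).prod = (p.reverse.map (ghost K r s)).prod := by
  induction p with
  | nil => simp
  | cons e p ih =>
    intro _
    by_cases hp : p = []
    · subst hp; simp
    · simp [involution_mul, ih hp]

@[simp]
theorem involution_pathE (p : List E) (v : V) :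
    involution K r s (pathE K r s p v) = pathStarE K r s p v := by
  by_cases hp : p = []
  · subst hp; simp [pathE, pathStarE]
  · simp [pathE, pathStarE, hp, involution_prod_map_edge r s p hp]

@[simp]
theorem involution_pathStarE (p : List E) (v : V) :
    involution K r s (pathStarE K r s p v) = pathE K r s p v := by
  rw [← involution_pathE, involution_involution]

@[simp]
theorem involution_gapL (H : Set V) (v : V) (hfin : {e : E | s e = v ∧ r e ∉ H}.Finite) :
    involution K r s (gapL K r s H v hfin) = gapL K r s H v hfin := by
  simp [gapL, involution_mul]

end Involution

section Paths

variable (r s : E → V)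

/-- The source of a path with range `v`. -/
def pathSource (s : E → V) (p : List E) (v : V) : V := (p.head?.map s).getD v

theorem rangedPath_iff {p : List E} {v : V} :
    RangedPath r s p v ↔ p.IsChain (pathRel r s) ∧ ∀ h : p ≠ [], r (p.getLast h) = v :=
  Iff.rfl

theorem rangedPath_nil (v : V) : RangedPath r s [] v :=
  ⟨List.isChain_nil, fun h => absurd rfl h⟩

theorem rangedPath_cons {e : E} {p : List E} {v : V} :
    RangedPath r s (e :: p) v ↔ r e = pathSource s p v ∧ RangedPath r s p v := by
  cases p with
  | nil => simp [rangedPath_iff, pathSource]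
  | cons f p => simp [rangedPath_iff, pathSource, pathRel, and_assoc]

theorem rangedPath_append_singleton {p : List E} {f : E} (hp : RangedPath r s p (s f)) :
    RangedPath r s (p ++ [f]) (r f) := by
  induction p with
  | nil => simp [rangedPath_iff]
  | cons e p ih =>
    rw [rangedPath_cons] at hp
    rw [List.cons_append, rangedPath_cons]
    refine ⟨?_, ih hp.2⟩
    rw [hp.1]
    cases p <;> simp [pathSource]

variable {K}

theorem pathE_nil (v : V) : pathE K r s [] v = vert K r s v := by simp [pathE]

theorem pathStarE_nil (v : V) : pathStarE K r s [] v = vert K r s v := by simp [pathStarE]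

theorem pathE_cons {e : E} {p : List E} {v : V} (h : r e = pathSource s p v) :
    pathE K r s (e :: p) v = edge K r s e * pathE K r s p v := by
  cases p with
  | nil =>
    obtain rfl : r e = v := by simpa [pathSource] using h
    simp [pathE, edge_mul_vert]
  | cons f p => simp [pathE]

theorem vert_mul_pathE (p : List E) (v : V) :
    vert K r s (pathSource s p v) * pathE K r s p v = pathE K r s p v := by
  cases p with
  | nil => simp [pathE, pathSource, vert_mul_self]
  | cons e p => simp [pathE, pathSource, ← mul_assoc, vert_mul_edge]

theorem vert_mul_pathE_of_ne {p : List E} {v w : V} (h : w ≠ pathSource s p v) :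
    vert K r s w * pathE K r s p v = 0 := by
  rw [← vert_mul_pathE, ← mul_assoc, vert_mul_vert_of_ne r s h, zero_mul]

theorem edge_mul_pathE_of_ne {e : E} {p : List E} {v : V} (h : r e ≠ pathSource s p v) :
    edge K r s e * pathE K r s p v = 0 := by
  rw [← edge_mul_vert, mul_assoc, vert_mul_pathE_of_ne r s h, mul_zero]

theorem ghost_mul_vert_of_ne {e : E} {v : V} (h : s e ≠ v) :
    ghost K r s e * vert K r s v = 0 := by
  rw [← ghost_mul_vert, mul_assoc, vert_mul_vert_of_ne r s h, mul_zero]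

theorem pathE_mul_vert {p : List E} {v : V} (hp : RangedPath r s p v) :
    pathE K r s p v * vert K r s v = pathE K r s p v := by
  induction p with
  | nil => simp [pathE, vert_mul_self]
  | cons e p ih =>
    rw [rangedPath_cons] at hp
    rw [pathE_cons r s hp.1, mul_assoc, ih hp.2]

theorem pathE_append_singleton {p : List E} {f : E} (hp : RangedPath r s p (s f)) :
    pathE K r s (p ++ [f]) (r f) = pathE K r s p (s f) * edge K r s f := by
  by_cases h : p = []
  · subst h; simp [pathE, vert_mul_edge]
  · simp [pathE, h]

theorem ghost_mul_pathStarE {q : List E} {f : E} (hq : RangedPath r s q (s f)) :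
    ghost K r s f * pathStarE K r s q (s f) = pathStarE K r s (q ++ [f]) (r f) := by
  rw [← involution_pathE r s (q ++ [f]), pathE_append_singleton r s hq, involution_mul]
  simp

theorem vert_mul_pathStarE {q : List E} {v : V} (hq : RangedPath r s q v) :
    vert K r s v * pathStarE K r s q v = pathStarE K r s q v := by
  rw [← involution_pathE, ← involution_vert, ← involution_mul, pathE_mul_vert r s hq]

end Paths

section Gap

variable {K} (r s : E → V) {H : Set V} {v : V} (hfin : {e : E | s e = v ∧ r e ∉ H}.Finite)

theorem vert_mul_gapL : vert K r s v * gapL K r s H v hfin = gapL K r s H v hfin := by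
  rw [gapL, mul_sub, vert_mul_self, Finset.mul_sum]
  congr 1
  refine Finset.sum_congr rfl fun e he => ?_
  obtain ⟨rfl, -⟩ := hfin.mem_toFinset.1 he
  rw [← mul_assoc, vert_mul_edge]

theorem gapL_mul_vert : gapL K r s H v hfin * vert K r s v = gapL K r s H v hfin := by
  have h := congrArg (involution K r s) (vert_mul_gapL (K := K) r s hfin)
  rwa [involution_mul, involution_vert, involution_gapL] at h

theorem ghost_mul_gapL_of_mem {f : E} (hf : s f = v) (h : r f ∈ H) :
    ghost K r s f * gapL K r s H v hfin = ghost K r s f := by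
  subst hf
  rw [gapL, mul_sub, ghost_mul_vert, Finset.mul_sum, Finset.sum_eq_zero, sub_zero]
  intro e he
  have hne : f ≠ e := by
    rintro rfl
    exact (hfin.mem_toFinset.1 he).2 h
  rw [← mul_assoc, ghost_mul_edge_of_ne r s hne, zero_mul]

theorem ghost_mul_gapL_of_notMem {f : E} (hf : s f = v) (h : r f ∉ H) :
    ghost K r s f * gapL K r s H v hfin = 0 := by
  subst hf
  rw [gapL, mul_sub, ghost_mul_vert, Finset.mul_sum, Finset.sum_eq_single f,
    ← mul_assoc, ghost_mul_edge_self, vert_mul_ghost, sub_self]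
  · intro e _ hne
    rw [← mul_assoc, ghost_mul_edge_of_ne r s hne.symm, zero_mul]
  · exact fun hf => absurd (hfin.mem_toFinset.2 ⟨rfl, h⟩) hf

end Gap

section Monomials

variable (r s : E → V) (H S : Set V) (hS : S ⊆ breakingVertices r s H)

/-- The monomials `αβ*` with range in `H` and `α v^H β*` with range `v ∈ S`. -/
def idealMonomials : Set (LPA K r s) :=
  {x | ∃ v ∈ H, ∃ p q : List E, RangedPath r s p v ∧ RangedPath r s q v ∧
      x = pathE K r s p v * pathStarE K r s q v} ∪
    {x | ∃ v : V, ∃ hv : v ∈ S, ∃ p q : List E, RangedPath r s p v ∧ RangedPath r s q v ∧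
      x = pathE K r s p v * gapL K r s H v ((hS hv).2.1) * pathStarE K r s q v}

variable {K} {r s H S}

theorem pathE_mul_pathStarE_mem {v : V} (hv : v ∈ H) {p q : List E} (hp : RangedPath r s p v)
    (hq : RangedPath r s q v) :
    pathE K r s p v * pathStarE K r s q v ∈ Submodule.span K (idealMonomials K r s H S hS) :=
  Submodule.subset_span (Or.inl ⟨v, hv, p, q, hp, hq, rfl⟩)

theorem pathE_mul_gapL_mul_pathStarE_mem {v : V} (hv : v ∈ S) {p q : List E}
    (hp : RangedPath r s p v) (hq : RangedPath r s q v) :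
    pathE K r s p v * gapL K r s H v ((hS hv).2.1) * pathStarE K r s q v ∈
      Submodule.span K (idealMonomials K r s H S hS) :=
  Submodule.subset_span (Or.inr ⟨v, hv, p, q, hp, hq, rfl⟩)

theorem involution_mem_span_idealMonomials {x : LPA K r s}
    (hx : x ∈ Submodule.span K (idealMonomials K r s H S hS)) :
    involution K r s x ∈ Submodule.span K (idealMonomials K r s H S hS) := by
  suffices h : Submodule.span K (idealMonomials K r s H S hS) ≤
      (Submodule.span K (idealMonomials K r s H S hS)).comap (involution K r s) from h hx
  refine Submodule.span_le.2 ?_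
  rintro _ (⟨v, hv, p, q, hp, hq, rfl⟩ | ⟨v, hv, p, q, hp, hq, rfl⟩)
  · simpa [involution_mul] using pathE_mul_pathStarE_mem hS hv hq hp
  · simpa [involution_mul, mul_assoc] using pathE_mul_gapL_mul_pathStarE_mem hS hv hq hp

/-- Left multiplication by `a` preserves the span of the monomials as soon as it does so on
monomials. -/
theorem mul_mem_span_of_forall {a : LPA K r s}
    (h₁ : ∀ v ∈ H, ∀ p q : List E, RangedPath r s p v → RangedPath r s q v →
      a * (pathE K r s p v * pathStarE K r s q v) ∈
        Submodule.span K (idealMonomials K r s H S hS))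
    (h₂ : ∀ v, ∀ hv : v ∈ S, ∀ p q : List E, RangedPath r s p v → RangedPath r s q v →
      a * (pathE K r s p v * gapL K r s H v ((hS hv).2.1) * pathStarE K r s q v) ∈
        Submodule.span K (idealMonomials K r s H S hS)) :
    ∀ x ∈ Submodule.span K (idealMonomials K r s H S hS),
      a * x ∈ Submodule.span K (idealMonomials K r s H S hS) := by
  suffices h : Submodule.span K (idealMonomials K r s H S hS) ≤
      (Submodule.span K (idealMonomials K r s H S hS)).comap (LinearMap.mulLeft K a) from
    fun x hx => h hx
  refine Submodule.span_le.2 ?_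
  rintro _ (⟨v, hv, p, q, hp, hq, rfl⟩ | ⟨v, hv, p, q, hp, hq, rfl⟩)
  exacts [h₁ v hv p q hp hq, h₂ v hv p q hp hq]

theorem vert_mul_mem_span (w : V) :
    ∀ x ∈ Submodule.span K (idealMonomials K r s H S hS),
      vert K r s w * x ∈ Submodule.span K (idealMonomials K r s H S hS) := by
  refine mul_mem_span_of_forall hS (fun v hv p q hp hq => ?_) (fun v hv p q hp hq => ?_) <;>
    by_cases hw : w = pathSource s p v
  · rw [hw, ← mul_assoc, vert_mul_pathE]
    exact pathE_mul_pathStarE_mem hS hv hp hq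
  · rw [← mul_assoc, vert_mul_pathE_of_ne r s hw, zero_mul]
    exact zero_mem _
  · rw [hw, ← mul_assoc, ← mul_assoc, vert_mul_pathE]
    exact pathE_mul_gapL_mul_pathStarE_mem hS hv hp hq
  · rw [← mul_assoc, ← mul_assoc, vert_mul_pathE_of_ne r s hw, zero_mul, zero_mul]
    exact zero_mem _

theorem edge_mul_mem_span (e : E) :
    ∀ x ∈ Submodule.span K (idealMonomials K r s H S hS),
      edge K r s e * x ∈ Submodule.span K (idealMonomials K r s H S hS) := by
  refine mul_mem_span_of_forall hS (fun v hv p q hp hq => ?_) (fun v hv p q hp hq => ?_) <;>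
    by_cases he : r e = pathSource s p v
  · rw [← mul_assoc, ← pathE_cons r s he]
    exact pathE_mul_pathStarE_mem hS hv ((rangedPath_cons r s).2 ⟨he, hp⟩) hq
  · rw [← mul_assoc, edge_mul_pathE_of_ne r s he, zero_mul]
    exact zero_mem _
  · rw [← mul_assoc, ← mul_assoc, ← pathE_cons r s he]
    exact pathE_mul_gapL_mul_pathStarE_mem hS hv ((rangedPath_cons r s).2 ⟨he, hp⟩) hq
  · rw [← mul_assoc, ← mul_assoc, edge_mul_pathE_of_ne r s he, zero_mul, zero_mul]
    exact zero_mem _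

theorem ghost_mul_pathE_cons {e : E} {p : List E} {v : V} (h : r e = pathSource s p v) :
    ghost K r s e * pathE K r s (e :: p) v = pathE K r s p v := by
  rw [pathE_cons r s h, ← mul_assoc, ghost_mul_edge_self, h, vert_mul_pathE]

theorem ghost_mul_pathE_cons_of_ne {e f : E} {p : List E} {v : V} (hne : f ≠ e)
    (h : r e = pathSource s p v) :
    ghost K r s f * pathE K r s (e :: p) v = 0 := by
  rw [pathE_cons r s h, ← mul_assoc, ghost_mul_edge_of_ne r s hne, zero_mul]

theorem ghost_mul_pathStarE_mem {f : E} (hf : r f ∈ H) {q : List E}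
    (hq : RangedPath r s q (s f)) :
    ghost K r s f * pathStarE K r s q (s f) ∈
      Submodule.span K (idealMonomials K r s H S hS) := by
  have hqf := rangedPath_append_singleton r s hq
  rw [ghost_mul_pathStarE r s hq, ← vert_mul_pathStarE r s hqf, ← pathE_nil]
  exact pathE_mul_pathStarE_mem hS hf (rangedPath_nil r s _) hqf

theorem ghost_mul_mem_span (hH : Hereditary r s H) (f : E) :
    ∀ x ∈ Submodule.span K (idealMonomials K r s H S hS),
      ghost K r s f * x ∈ Submodule.span K (idealMonomials K r s H S hS) := by
  refine mul_mem_span_of_forall hS (fun v hv p q hp hq => ?_) (fun v hv p q hp hq => ?_)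
  · rw [← mul_assoc]
    cases p with
    | nil =>
      rw [pathE_nil]
      by_cases hf : s f = v
      · subst hf
        rw [ghost_mul_vert]
        exact ghost_mul_pathStarE_mem hS (hH f hv) hq
      · rw [ghost_mul_vert_of_ne r s hf, zero_mul]
        exact zero_mem _
    | cons e p =>
      rw [rangedPath_cons] at hp
      by_cases hfe : f = e
      · subst hfe
        rw [ghost_mul_pathE_cons hp.1]
        exact pathE_mul_pathStarE_mem hS hv hp.2 hq
      · rw [ghost_mul_pathE_cons_of_ne hfe hp.1, zero_mul]
        exact zero_mem _
  · rw [← mul_assoc, ← mul_assoc]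
    cases p with
    | nil =>
      rw [pathE_nil]
      by_cases hf : s f = v
      · subst hf
        rw [ghost_mul_vert]
        by_cases hr : r f ∈ H
        · rw [ghost_mul_gapL_of_mem r s _ rfl hr]
          exact ghost_mul_pathStarE_mem hS hr hq
        · rw [ghost_mul_gapL_of_notMem r s _ rfl hr, zero_mul]
          exact zero_mem _
      · rw [ghost_mul_vert_of_ne r s hf, zero_mul, zero_mul]
        exact zero_mem _
    | cons e p =>
      rw [rangedPath_cons] at hp
      by_cases hfe : f = e
      · subst hfe
        rw [ghost_mul_pathE_cons hp.1]
        exact pathE_mul_gapL_mul_pathStarE_mem hS hv hp.2 hq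
      · rw [ghost_mul_pathE_cons_of_ne hfe hp.1, zero_mul, zero_mul]
        exact zero_mem _

theorem mul_mem_span_left (hH : Hereditary r s H) (a : LPA K r s) {x : LPA K r s}
    (hx : x ∈ Submodule.span K (idealMonomials K r s H S hS)) :
    a * x ∈ Submodule.span K (idealMonomials K r s H S hS) :=
  mul_mem_of_generators r s _ (vert_mul_mem_span hS) (edge_mul_mem_span hS)
    (ghost_mul_mem_span hS hH) a x hx

theorem mul_mem_span_right (hH : Hereditary r s H) {x : LPA K r s} (a : LPA K r s)
    (hx : x ∈ Submodule.span K (idealMonomials K r s H S hS)) :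
    x * a ∈ Submodule.span K (idealMonomials K r s H S hS) := by
  rw [← involution_involution r s (x * a), involution_mul]
  exact involution_mem_span_idealMonomials hS
    (mul_mem_span_left hS hH _ (involution_mem_span_idealMonomials hS hx))

theorem idealGens_subset_span :
    idealGens K r s H S hS ⊆ Submodule.span K (idealMonomials K r s H S hS) := by
  rintro _ (⟨v, hv, rfl⟩ | ⟨v, hv, rfl⟩)
  · have h := pathE_mul_pathStarE_mem (K := K) hS hv (rangedPath_nil r s v) (rangedPath_nil r s v)
    rwa [pathE_nil, pathStarE_nil, vert_mul_self] at h
  · have h := pathE_mul_gapL_mul_pathStarE_mem (K := K) hS hv (rangedPath_nil r s v)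
      (rangedPath_nil r s v)
    rwa [pathE_nil, pathStarE_nil, vert_mul_gapL, gapL_mul_vert] at h

theorem idealMonomials_subset_span :
    idealMonomials K r s H S hS ⊆ TwoSidedIdeal.span (idealGens K r s H S hS) := by
  rintro _ (⟨v, hv, p, q, hp, hq, rfl⟩ | ⟨v, hv, p, q, hp, hq, rfl⟩)
  · rw [← pathE_mul_vert r s hp]
    exact TwoSidedIdeal.mul_mem_right _ _ _ (TwoSidedIdeal.mul_mem_left _ _ _
      (TwoSidedIdeal.subset_span (Or.inl ⟨v, hv, rfl⟩)))
  · exact TwoSidedIdeal.mul_mem_right _ _ _ (TwoSidedIdeal.mul_mem_left _ _ _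
      (TwoSidedIdeal.subset_span (Or.inr ⟨v, hv, rfl⟩)))

end Monomials

/-- For `H` saturated hereditary and `S ⊆ B_H`, the two-sided
ideal `I_{(H,S)}` of `L_K(E)` generated by `{v : v ∈ H} ∪ {v^H : v ∈ S}` equals the
`K`-linear span of
`{αβ* : α, β paths with r(α) = r(β) ∈ H} ∪ {α v^H β* : r(α) = r(β) = v ∈ S}`
(paths of length `0` being vertices). -/
theorem ideal_eq_span_monomials
    (r s : E → V) (H S : Set V) (hH : Hereditary r s H) (hSat : Saturated r s H)
    (hS : S ⊆ breakingVertices r s H) :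
    ∀ x : LPA K r s,
      x ∈ TwoSidedIdeal.span (idealGens K r s H S hS) ↔
      x ∈ Submodule.span K
        ({x | ∃ v ∈ H, ∃ p q : List E, RangedPath r s p v ∧ RangedPath r s q v ∧
            x = pathE K r s p v * pathStarE K r s q v} ∪
         {x | ∃ v : V, ∃ hv : v ∈ S, ∃ p q : List E,
            RangedPath r s p v ∧ RangedPath r s q v ∧
            x = pathE K r s p v * gapL K r s H v ((hS hv).2.1) *
              pathStarE K r s q v} : Set (LPA K r s)) := by
  intro x
  change _ ↔ x ∈ Submodule.span K (idealMonomials K r s H S hS)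
  constructor
  · intro hx
    let I : TwoSidedIdeal (LPA K r s) :=
      TwoSidedIdeal.mk' (Submodule.span K (idealMonomials K r s H S hS)) (zero_mem _)
        add_mem neg_mem (mul_mem_span_left hS hH _) (mul_mem_span_right hS hH _)
    have hI : ∀ y, y ∈ I ↔ y ∈ Submodule.span K (idealMonomials K r s H S hS) := fun y =>
      TwoSidedIdeal.mem_mk' ..
    exact (hI x).1 (TwoSidedIdeal.mem_span_iff.1 hx I fun y hy =>
      (hI y).2 (idealGens_subset_span hS hy))
  · intro hx
    induction hx using Submodule.span_induction with
    | mem x hx => exact idealMonomials_subset_span hS hx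
    | zero => exact zero_mem _
    | add x y _ _ hx hy => exact add_mem hx hy
    | smul c x _ hx =>
      rw [Algebra.smul_def]
      exact TwoSidedIdeal.mul_mem_left _ _ _ hx

end LPA

end GraphIdeals
end
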